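/- arXiv:1104.1827 — 10 statements merged into one kernel-verified Lean document; each statement's English description precedes it below -/
import Mathlib

section
/- Let X be a real Banach space, (x_n) a sequence in X and x ∈ X. Then (x_n) converges weakly to x if and only if for every subsequence (x'_n) of (x_n) there exists a sequence (y_n) of finite convex combinations of elements of (x'_n) such that ‖y_n − x‖ → 0 as n → ∞. -/
open Filter Topology

/-- **Mazur's lemma**: a weak sequential limit lies in the norm closure of the convex hull. -/
lemma mem_closure_convexHull_range_of_tendsto {X : Type*} [NormedAddCommGroup X]
    [NormedSpace ℝ X] {u : ℕ → X} {a : X}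
    (h : ∀ φ : X →L[ℝ] ℝ, Tendsto (fun n => φ (u n)) atTop (𝓝 (φ a))) :
    a ∈ closure (convexHull ℝ (Set.range u)) := by
  by_contra ha
  obtain ⟨φ, c, hc, hca⟩ := geometric_hahn_banach_closed_point
    (convex_convexHull ℝ (Set.range u)).closure isClosed_closure ha
  exact hca.not_ge (le_of_tendsto' (h φ) fun n =>
    (hc _ (subset_closure (subset_convexHull ℝ _ ⟨n, rfl⟩))).le)

/-- If `a` lies in the closed convex hull of every subsequence of `u`, then every strict lower
bound of `φ a` is eventually a strict lower bound of `φ (u n)`. -/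
lemma eventually_lt_of_mem_closure_convexHull {X : Type*} [NormedAddCommGroup X]
    [NormedSpace ℝ X] {u : ℕ → X} {a : X}
    (h : ∀ k : ℕ → ℕ, StrictMono k →
      a ∈ closure (convexHull ℝ (Set.range fun m => u (k m))))
    (φ : X →L[ℝ] ℝ) {c : ℝ} (hc : c < φ a) : ∀ᶠ n in atTop, c < φ (u n) := by
  by_contra hn
  obtain ⟨k, hk, hkc⟩ := extraction_of_frequently_atTop (not_eventually.mp hn)
  have hsub : closure (convexHull ℝ (Set.range fun m => u (k m))) ⊆ {z | φ z ≤ c} := by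
    refine closure_minimal (convexHull_min ?_ (convex_halfSpace_le φ.isLinear c))
      (isClosed_le φ.continuous continuous_const)
    rintro _ ⟨m, rfl⟩
    exact not_lt.mp (hkc m)
  exact hc.not_ge (hsub (h k hk))

/-- **Converse of Mazur's theorem.** A sequence `(x n)` in a real Banach space `X`
converges weakly to `x₀` if and only if for every subsequence of `(x n)` there is a
sequence of finite convex combinations of its elements converging to `x₀` in norm. -/
theorem weak_convergence_iff_convex_combinations_of_subsequences
    {X : Type*} [NormedAddCommGroup X] [NormedSpace ℝ X] [CompleteSpace X]
    (x : ℕ → X) (x₀ : X) :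
    (∀ φ : X →L[ℝ] ℝ, Tendsto (fun n => φ (x n)) atTop (𝓝 (φ x₀))) ↔
      (∀ k : ℕ → ℕ, StrictMono k →
        ∃ y : ℕ → X, (∀ n, y n ∈ convexHull ℝ (Set.range (fun m => x (k m)))) ∧
          Tendsto (fun n => ‖y n - x₀‖) atTop (𝓝 0)) := by
  have hcl (s : Set X) : (∃ y : ℕ → X, (∀ n, y n ∈ s) ∧
      Tendsto (fun n => ‖y n - x₀‖) atTop (𝓝 0)) ↔ x₀ ∈ closure s := by
    simp only [mem_closure_iff_seq_limit, ← tendsto_iff_norm_sub_tendsto_zero]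
  simp only [hcl]
  refine ⟨fun h k hk => mem_closure_convexHull_range_of_tendsto fun φ =>
    (h φ).comp hk.tendsto_atTop, fun h φ => tendsto_order.mpr ⟨fun c hc =>
      eventually_lt_of_mem_closure_convexHull h φ hc, fun c hc => ?_⟩⟩
  have := eventually_lt_of_mem_closure_convexHull h (-φ) (c := -c) (by simpa using hc)
  simpa using this
end

section
/- For every infinite-dimensional complex Hilbert space H there exists a bounded, uniformly continuous function f : ℝ → H such that f ∈ EAP_0(ℝ,H) (the orbit {f_s : s ∈ ℝ} is relatively compact in the weak topology of C_b(ℝ,H) and 0 lies in the weak closure of the orbit), while neither lim_{T→∞} (1/(2T)) ∫_{−T}^{T} ‖f(t)‖ dt nor lim_{T→∞} (1/(2T)) ∫_{−T}^{T} ‖f(t)‖² dt exists. -/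
open BoundedContinuousFunction Filter Topology

/-- The translate `f_s` of `f : ℝ →ᵇ X`, defined by `f_s t = f (s + t)`. -/
noncomputable def translateBCF {X : Type*} [SeminormedAddCommGroup X] (f : ℝ →ᵇ X) (s : ℝ) :
    ℝ →ᵇ X :=
  f.compContinuous ⟨fun t => s + t, by continuity⟩

theorem exists_orthonormal_nat {H : Type*} [NormedAddCommGroup H] [InnerProductSpace ℂ H]
    (hH : ¬ FiniteDimensional ℂ H) : ∃ e : ℕ → H, Orthonormal ℂ e := by
  let b := Module.Basis.ofVectorSpace ℂ H
  have : Infinite (Module.Basis.ofVectorSpaceIndex ℂ H) := by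
    by_contra h
    rw [not_infinite_iff_finite] at h
    exact hH (Module.Finite.of_basis b)
  exact ⟨_, InnerProductSpace.gramSchmidtNormed_orthonormal
    (b.linearIndependent.comp _ (Infinite.natEmbedding _).injective)⟩

/-- The distance from a real number to the nearest integer. -/
noncomputable def distInt (t : ℝ) : ℝ := |t - round t|

theorem distInt_nonneg (t : ℝ) : 0 ≤ distInt t := abs_nonneg _

theorem distInt_le (t : ℝ) (m : ℤ) : distInt t ≤ |t - m| := round_le t m

theorem distInt_le_one (t : ℝ) : distInt t ≤ 1 := (abs_sub_round t).trans (by norm_num)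

theorem abs_distInt_sub_le (s t : ℝ) : |distInt s - distInt t| ≤ |s - t| := by
  have key (s t : ℝ) : distInt s - distInt t ≤ |s - t| := by
    have h₁ := distInt_le s (round t)
    have h₂ := abs_sub_le s t (round t)
    simp only [distInt] at *
    linarith
  rw [abs_sub_le_iff]
  exact ⟨key s t, abs_sub_comm s t ▸ key t s⟩

theorem continuous_distInt : Continuous distInt := by
  refine (LipschitzWith.of_dist_le_mul (K := 1) fun s t => ?_).continuous
  simpa [Real.dist_eq] using abs_distInt_sub_le s t

theorem distInt_periodic : Function.Periodic distInt 1 := fun t => by simp [distInt, round_add_one]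

theorem distInt_pos {t : ℝ} (h0 : 0 < t) (h1 : t < 1) : 0 < distInt t := by
  refine abs_pos.2 fun h => ?_
  have h' : t = (round t : ℝ) := sub_eq_zero.1 h
  rw [h'] at h0 h1
  norm_cast at h0 h1
  omega

theorem integral_distInt_pow_pos (p : ℕ) : 0 < ∫ t in (0 : ℝ)..1, distInt t ^ p :=
  intervalIntegral.intervalIntegral_pos_of_pos_on
    ((continuous_distInt.pow p).intervalIntegrable _ _)
    (fun _ ht => pow_pos (distInt_pos ht.1 ht.2) p) one_pos

/-- On `[n, n + 1)`, a bump in the direction `e n` if `n` lies in a dyadic interval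
`[2 ^ j, 2 ^ (j + 1))` with `j` odd, and zero otherwise. -/
noncomputable def dyadicBumps {H : Type*} [NormedAddCommGroup H] [InnerProductSpace ℂ H]
    (e : ℕ → H) (t : ℝ) : H :=
  if Odd (Nat.log 2 ⌊t⌋₊) then (distInt t : ℂ) • e ⌊t⌋₊ else 0

section DyadicBumps

variable {H : Type*} [NormedAddCommGroup H] [InnerProductSpace ℂ H] {e : ℕ → H}

theorem norm_dyadicBumps (he : Orthonormal ℂ e) (t : ℝ) :
    ‖dyadicBumps e t‖ = if Odd (Nat.log 2 ⌊t⌋₊) then distInt t else 0 := by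
  unfold dyadicBumps
  split_ifs <;> simp [norm_smul, he.1, abs_of_nonneg (distInt_nonneg t)]

theorem norm_dyadicBumps_le_distInt (he : Orthonormal ℂ e) (t : ℝ) :
    ‖dyadicBumps e t‖ ≤ distInt t := by
  rw [norm_dyadicBumps he]
  split_ifs
  exacts [le_rfl, distInt_nonneg t]

theorem norm_dyadicBumps_sub_le (he : Orthonormal ℂ e) (s t : ℝ) :
    ‖dyadicBumps e s - dyadicBumps e t‖ ≤ |s - t| := by
  wlog hst : s ≤ t generalizing s t
  · rw [norm_sub_rev, abs_sub_comm]
    exact this t s (le_of_not_ge hst)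
  rcases (Nat.floor_mono hst).eq_or_lt with h | h
  · unfold dyadicBumps
    rw [h]
    split_ifs
    · rw [← sub_smul, norm_smul, he.1, mul_one, ← Complex.ofReal_sub, Complex.norm_real]
      exact abs_distInt_sub_le s t
    · simp
  · have hs : s < (⌊t⌋₊ : ℝ) := Nat.lt_of_floor_lt h
    have ht : (⌊t⌋₊ : ℝ) ≤ t := Nat.floor_le (Nat.pos_of_floor_pos (by omega)).le
    have h₁ := (norm_dyadicBumps_le_distInt he s).trans (distInt_le s ⌊t⌋₊)
    have h₂ := (norm_dyadicBumps_le_distInt he t).trans (distInt_le t ⌊t⌋₊)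
    push_cast at h₁ h₂
    rw [abs_of_neg (by linarith)] at h₁
    rw [abs_of_nonneg (by linarith)] at h₂
    rw [abs_of_nonpos (by linarith)]
    linarith [norm_sub_le (dyadicBumps e s) (dyadicBumps e t)]

theorem lipschitzWith_dyadicBumps (he : Orthonormal ℂ e) : LipschitzWith 1 (dyadicBumps e) :=
  LipschitzWith.of_dist_le_mul fun s t => by
    simpa [dist_eq_norm] using norm_dyadicBumps_sub_le he s t

theorem inner_dyadicBumps (he : Orthonormal ℂ e) {s t : ℝ} (hst : 1 ≤ dist s t) :
    inner ℂ (dyadicBumps e s) (dyadicBumps e t) = 0 := by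
  by_cases h : ⌊s⌋₊ = ⌊t⌋₊
  · have h0 : ⌊t⌋₊ = 0 := by
      by_contra h0
      have hs := Nat.floor_le (Nat.pos_of_floor_pos (a := s) (by omega)).le
      have ht := Nat.floor_le (Nat.pos_of_floor_pos (a := t) (by omega)).le
      have hs' := Nat.lt_floor_add_one s
      have ht' := Nat.lt_floor_add_one t
      rw [h] at hs hs'
      rw [Real.dist_eq] at hst
      exact absurd (abs_lt.2 ⟨by linarith, by linarith⟩) hst.not_gt
    simp [dyadicBumps, h0]
  · unfold dyadicBumps
    split_ifs
    · rw [inner_smul_left, inner_smul_right, he.2 h, mul_zero, mul_zero]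
    all_goals simp

/-- `dyadicBumps` as a bounded continuous function. -/
noncomputable def dyadicBumpsBCF (he : Orthonormal ℂ e) : ℝ →ᵇ H :=
  BoundedContinuousFunction.ofNormedAddCommGroup (dyadicBumps e)
    (lipschitzWith_dyadicBumps he).continuous 1
    fun t => (norm_dyadicBumps_le_distInt he t).trans (distInt_le_one t)

theorem translateBCF_dyadicBumpsBCF_apply (he : Orthonormal ℂ e) (s t : ℝ) :
    translateBCF (dyadicBumpsBCF he) s t = dyadicBumps e (s + t) := rfl

theorem continuous_translateBCF_dyadicBumpsBCF (he : Orthonormal ℂ e) :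
    Continuous (translateBCF (dyadicBumpsBCF he)) := by
  refine (LipschitzWith.of_dist_le_mul (K := 1) fun s s' => ?_).continuous
  refine (BoundedContinuousFunction.dist_le (by positivity)).2 fun t => ?_
  rw [translateBCF_dyadicBumpsBCF_apply, translateBCF_dyadicBumpsBCF_apply]
  simpa using (lipschitzWith_dyadicBumps he).dist_le_mul (s + t) (s' + t)

end DyadicBumps

theorem norm_sum_sq_le_card_of_orthogonal {ι H : Type*} [NormedAddCommGroup H]
    [InnerProductSpace ℂ H] (S : Finset ι) (v : ι → H) (hv : ∀ i ∈ S, ‖v i‖ ≤ 1)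
    (ho : (S : Set ι).Pairwise fun i j => inner ℂ (v i) (v j) = 0) :
    ‖∑ i ∈ S, v i‖ ^ 2 ≤ S.card := by
  classical
  induction S using Finset.induction_on with
  | empty => simp
  | insert a S ha ih =>
    have h := ih (fun i hi => hv i (Finset.mem_insert_of_mem hi))
      (ho.mono (by simp))
    have h0 : inner ℂ (v a) (∑ i ∈ S, v i) = 0 := by
      rw [inner_sum]
      refine Finset.sum_eq_zero fun i hi => ho (by simp) (by simp [hi]) ?_
      rintro rfl
      exact ha hi
    rw [Finset.sum_insert ha, @norm_add_sq ℂ, h0, Finset.card_insert_of_notMem ha]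
    have h1 := hv a (by simp)
    have h2 : ‖v a‖ ^ 2 ≤ 1 := pow_le_one₀ (norm_nonneg _) h1
    simp only [map_zero, mul_zero, add_zero]
    push_cast
    linarith

theorem exists_separated_finset {X : Type*} [PseudoMetricSpace X] [ProperSpace X] {P : X → Prop}
    (hP : ∃ᶠ x in cocompact X, P x) (N : ℕ) :
    ∃ S : Finset X, S.card = N ∧ (∀ x ∈ S, P x) ∧
      (S : Set X).Pairwise fun x y => 1 ≤ dist x y := by
  classical
  induction N with
  | zero => exact ⟨∅, by simp⟩
  | succ N ih =>
    obtain ⟨S, hc, hS, hd⟩ := ih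
    have hfar : ∀ᶠ x in cocompact X, ∀ y ∈ S, 1 ≤ dist x y :=
      (Filter.eventually_all_finset S).2 fun y _ =>
        (tendsto_dist_right_cocompact_atTop y).eventually_ge_atTop 1
    obtain ⟨x, hx, hxS⟩ := (hP.and_eventually hfar).exists
    have hxn : x ∉ S := fun h => by
      have := hxS x h
      norm_num at this
    refine ⟨insert x S, by rw [Finset.card_insert_of_notMem hxn, hc], ?_, ?_⟩
    · simpa [hx] using hS
    · rw [Finset.coe_insert]
      refine hd.insert fun y hy _ => ⟨hxS y hy, ?_⟩
      rw [dist_comm]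
      exact hxS y hy

theorem norm_sum_smul_translateBCF_sq_le {H : Type*} [NormedAddCommGroup H]
    [InnerProductSpace ℂ H] {e : ℕ → H} (he : Orthonormal ℂ e) (S : Finset ℝ)
    (hS : (S : Set ℝ).Pairwise fun x y => 1 ≤ dist x y) (c : ℝ → ℂ) (hc : ∀ s ∈ S, ‖c s‖ ≤ 1) :
    ‖∑ s ∈ S, c s • translateBCF (dyadicBumpsBCF he) s‖ ≤ √S.card := by
  refine (BoundedContinuousFunction.norm_le (Real.sqrt_nonneg _)).2 fun t => ?_
  refine Real.le_sqrt_of_sq_le ?_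
  simp only [BoundedContinuousFunction.coe_sum, BoundedContinuousFunction.coe_smul,
    Finset.sum_apply, translateBCF_dyadicBumpsBCF_apply]
  refine norm_sum_sq_le_card_of_orthogonal S _ (fun s hs => ?_) fun s hs s' hs' hne => ?_
  · rw [norm_smul]
    exact mul_le_one₀ (hc s hs) (norm_nonneg _)
      ((norm_dyadicBumps_le_distInt he _).trans (distInt_le_one _))
  · beta_reduce
    rw [inner_smul_left, inner_smul_right,
      inner_dyadicBumps he (by simpa using hS hs hs' hne)]
    simp

theorem tendsto_dual_translateBCF_cocompact {H : Type*} [NormedAddCommGroup H]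
    [InnerProductSpace ℂ H] {e : ℕ → H} (he : Orthonormal ℂ e) (L : (ℝ →ᵇ H) →L[ℂ] ℂ) :
    Tendsto (fun s => L (translateBCF (dyadicBumpsBCF he) s)) (cocompact ℝ) (𝓝 0) := by
  rw [NormedAddGroup.tendsto_nhds_zero]
  intro ε hε
  by_contra hcon
  obtain ⟨N, hN⟩ := exists_nat_gt ((‖L‖ / ε) ^ 2)
  obtain ⟨S, hcard, hS, hsep⟩ := exists_separated_finset (Filter.not_eventually.1 hcon) N
  let z : ℝ → ℂ := fun s => L (translateBCF (dyadicBumpsBCF he) s)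
  let c : ℝ → ℂ := fun s => (starRingEnd ℂ (z s)) / (‖z s‖ : ℂ)
  have hc : ∀ s ∈ S, ‖c s‖ ≤ 1 := fun s _ => by
    simpa [c] using div_self_le_one ‖z s‖
  have hcz : ∀ s, c s * z s = (‖z s‖ : ℂ) := fun s => by
    by_cases h : z s = 0
    · simp [c, h]
    · have : (‖z s‖ : ℂ) ≠ 0 := by simpa using h
      simp only [c]
      rw [div_mul_eq_mul_div, Complex.conj_mul', sq, mul_div_assoc, div_self this, mul_one]
  have hsum : L (∑ s ∈ S, c s • translateBCF (dyadicBumpsBCF he) s) =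
      ((∑ s ∈ S, ‖z s‖ : ℝ) : ℂ) := by
    rw [map_sum, Complex.ofReal_sum]
    exact Finset.sum_congr rfl fun s _ => by rw [map_smul, smul_eq_mul, ← hcz s]
  have hlow : N * ε ≤ ∑ s ∈ S, ‖z s‖ := by
    rw [← hcard, ← nsmul_eq_mul]
    exact Finset.card_nsmul_le_sum _ _ _ fun s hs => not_lt.1 (hS s hs)
  have hup : ∑ s ∈ S, ‖z s‖ ≤ ‖L‖ * √N := by
    have h := L.le_opNorm_of_le (norm_sum_smul_translateBCF_sq_le he S hsep c hc)
    rwa [hsum, Complex.norm_real, Real.norm_of_nonneg (Finset.sum_nonneg fun _ _ => norm_nonneg _),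
      hcard] at h
  have hNpos : (0 : ℝ) < N := (sq_nonneg _).trans_lt hN
  have hs : ‖L‖ / ε < √N := Real.lt_sqrt_of_sq_lt hN
  have hsq : √(N : ℝ) * √N = N := Real.mul_self_sqrt hNpos.le
  have hsp : 0 < √(N : ℝ) := Real.sqrt_pos.2 hNpos
  rw [div_lt_iff₀ hε] at hs
  nlinarith

theorem tendsto_toWeakSpace_iff {E α : Type*} [NormedAddCommGroup E] [NormedSpace ℂ E]
    {l : Filter α} {u : α → E} {x : E} :
    Tendsto (fun a => toWeakSpace ℂ E (u a)) l (𝓝 (toWeakSpace ℂ E x)) ↔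
      ∀ L : E →L[ℂ] ℂ, Tendsto (fun a => L (u a)) l (𝓝 (L x)) := by
  have h : IsInducing fun (x : WeakSpace ℂ E) (L : E →L[ℂ] ℂ) => L ((toWeakSpace ℂ E).symm x) :=
    ⟨rfl⟩
  rw [h.tendsto_nhds_iff, tendsto_pi_nhds]
  rfl

theorem not_tendsto_mean_of_dyadic {g ψ : ℝ → ℝ} (hg : Continuous g) (hψ : Continuous ψ)
    (hper : Function.Periodic ψ 1) (hc : (∫ t in (0 : ℝ)..1, ψ t) ≠ 0)
    (hgψ : ∀ t, g t = if Odd (Nat.log 2 ⌊t⌋₊) then ψ t else 0) :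
    ¬ ∃ L : ℝ, Tendsto (fun T : ℝ => (1 / (2 * T)) * ∫ t in (-T)..T, g t) atTop (𝓝 L) := by
  rintro ⟨L, hL⟩
  set c := ∫ t in (0 : ℝ)..1, ψ t
  have hgi (a b : ℝ) : IntervalIntegrable g MeasureTheory.volume a b := hg.intervalIntegrable a b
  have hlog (j : ℕ) {t : ℝ} (ht : t ∈ Set.Ioo ((2 : ℝ) ^ j) (2 ^ (j + 1))) :
      Nat.log 2 ⌊t⌋₊ = j := by
    have h0 : 0 ≤ t := (by positivity : (0 : ℝ) ≤ 2 ^ j).trans ht.1.le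
    refine Nat.log_eq_of_pow_le_of_lt_pow (Nat.le_floor ?_) ((Nat.floor_lt h0).2 ?_)
    · exact_mod_cast ht.1.le
    · exact_mod_cast ht.2
  have hneg {a b : ℝ} (ha : a ≤ 0) (hb : b ≤ 0) : ∫ t in a..b, g t = 0 := by
    rw [intervalIntegral.integral_congr (g := fun _ => (0 : ℝ)), intervalIntegral.integral_zero]
    intro t ht
    have ht0 : t ≤ 0 := ht.2.trans (max_le ha hb)
    simp [hgψ, Nat.floor_of_nonpos ht0]
  have hstep (j : ℕ) : ∫ t in ((2 : ℝ) ^ j)..(2 ^ (j + 1)), g t =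
      if Odd j then 2 ^ j * c else 0 := by
    have hle : (2 : ℝ) ^ j ≤ 2 ^ (j + 1) := pow_le_pow_right₀ one_le_two j.le_succ
    split_ifs with hj
    · rw [intervalIntegral.integral_congr_Ioo_of_le hle (g := ψ)
        fun t ht => by simp only [hgψ, hlog j ht, hj, if_true]]
      have h := hper.intervalIntegral_add_zsmul_eq (2 ^ j : ℤ) (2 ^ j)
        fun a b => hψ.intervalIntegrable a b
      rw [hper.intervalIntegral_add_eq _ 0, zero_add] at h
      convert h using 2
      · simp [pow_succ]; ring
      · simp [c]
    · rw [intervalIntegral.integral_congr_Ioo_of_le hle (g := fun _ => (0 : ℝ))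
        fun t ht => by simp only [hgψ, hlog j ht, hj, if_false], intervalIntegral.integral_zero]
  let u : ℕ → ℝ := fun j => (1 / (2 * 2 ^ j)) * ∫ t in (-2 ^ j : ℝ)..2 ^ j, g t
  have hu : Tendsto u atTop (𝓝 L) :=
    hL.comp (tendsto_pow_atTop_atTop_of_one_lt (one_lt_two (α := ℝ)))
  have hrec (j : ℕ) : u (j + 1) = u j / 2 + if Odd j then c / 4 else 0 := by
    have hp : (0 : ℝ) < 2 ^ j := by positivity
    have hp' : (0 : ℝ) < 2 ^ (j + 1) := by positivity
    have hsplit : ∫ t in (-2 ^ (j + 1) : ℝ)..2 ^ (j + 1), g t =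
        (∫ t in (-2 ^ j : ℝ)..2 ^ j, g t) + if Odd j then 2 ^ j * c else 0 := by
      rw [← hstep j, intervalIntegral.integral_add_adjacent_intervals (hgi _ _) (hgi _ _),
        ← intervalIntegral.integral_add_adjacent_intervals (hgi _ (-2 ^ j)) (hgi _ _),
        hneg (by linarith) (by linarith), zero_add]
    simp only [u, hsplit]
    split_ifs <;> field_simp <;> ring
  have heven : L = L / 2 := by
    have hsub : Tendsto (fun k : ℕ => 2 * k) atTop atTop := tendsto_id.const_mul_atTop' two_pos
    refine tendsto_nhds_unique (hu.comp ((tendsto_add_atTop_nat 1).comp hsub))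
      (((hu.comp hsub).div_const 2).congr fun k => ?_)
    simp [hrec]
  have hodd : L = L / 2 + c / 4 := by
    have hsub : Tendsto (fun k : ℕ => 2 * k + 1) atTop atTop :=
      (tendsto_add_atTop_nat 1).comp (tendsto_id.const_mul_atTop' two_pos)
    refine tendsto_nhds_unique (hu.comp ((tendsto_add_atTop_nat 1).comp hsub))
      ((((hu.comp hsub).div_const 2).add_const (c / 4)).congr fun k => ?_)
    simp [hrec]
  exact hc (by linarith)

theorem not_tendsto_mean_norm_dyadicBumps_pow {H : Type*} [NormedAddCommGroup H]
    [InnerProductSpace ℂ H] {e : ℕ → H} (he : Orthonormal ℂ e) {p : ℕ} (hp : p ≠ 0) :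
    ¬ ∃ L : ℝ, Tendsto (fun T : ℝ => (1 / (2 * T)) * ∫ t in (-T)..T, ‖dyadicBumps e t‖ ^ p)
      atTop (𝓝 L) := by
  refine not_tendsto_mean_of_dyadic ((lipschitzWith_dyadicBumps he).continuous.norm.pow p)
    (continuous_distInt.pow p) (fun t => ?_) (integral_distInt_pow_pos p).ne' fun t => ?_
  · simp only [Pi.pow_apply, distInt_periodic t]
  · simp only [norm_dyadicBumps he, ite_pow, zero_pow hp, Pi.pow_apply]

/-- For every infinite-dimensional complex Hilbert space `H` there is a bounded uniformly
continuous `f : ℝ → H` lying in `EAP₀(ℝ,H)` (the orbit `{f_s : s ∈ ℝ}` is relatively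
compact in the weak topology of `C_b(ℝ,H)` and `0` is in the weak closure of the orbit),
while neither the Cesàro mean of `‖f(t)‖` nor that of `‖f(t)‖²` over `[-T,T]` converges. -/
theorem exists_EAP0_with_nonergodic_norm
    (H : Type*) [NormedAddCommGroup H] [InnerProductSpace ℂ H] [CompleteSpace H]
    (hH : ¬ FiniteDimensional ℂ H) :
    ∃ f : ℝ →ᵇ H, UniformContinuous ⇑f ∧
      IsCompact (closure ((toWeakSpace ℂ (ℝ →ᵇ H)) '' Set.range (translateBCF f))) ∧
      (0 : WeakSpace ℂ (ℝ →ᵇ H)) ∈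
        closure ((toWeakSpace ℂ (ℝ →ᵇ H)) '' Set.range (translateBCF f)) ∧
      (¬ ∃ L : ℝ, Tendsto (fun T : ℝ => (1/(2*T)) * ∫ t in (-T)..T, ‖f t‖) atTop (𝓝 L)) ∧
      (¬ ∃ L : ℝ, Tendsto (fun T : ℝ => (1/(2*T)) * ∫ t in (-T)..T, ‖f t‖^2) atTop (𝓝 L)) := by
  obtain ⟨e, he⟩ := exists_orthonormal_nat hH
  have htend : Tendsto (fun s => toWeakSpace ℂ (ℝ →ᵇ H) (translateBCF (dyadicBumpsBCF he) s))
      (cocompact ℝ) (𝓝 0) := by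
    rw [← map_zero (toWeakSpace ℂ (ℝ →ᵇ H)), tendsto_toWeakSpace_iff]
    exact fun L => by simpa using tendsto_dual_translateBCF_cocompact he L
  have hcont : Continuous fun s => toWeakSpace ℂ (ℝ →ᵇ H) (translateBCF (dyadicBumpsBCF he) s) :=
    (toWeakSpaceCLM ℂ (ℝ →ᵇ H)).continuous.comp (continuous_translateBCF_dyadicBumpsBCF he)
  refine ⟨dyadicBumpsBCF he, (lipschitzWith_dyadicBumps he).uniformContinuous, ?_, ?_, ?_,
    not_tendsto_mean_norm_dyadicBumps_pow he two_ne_zero⟩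
  · refine (htend.isCompact_insert_range_of_cocompact hcont).closure_of_subset ?_
    rintro _ ⟨_, ⟨s, rfl⟩, rfl⟩
    exact Set.mem_insert_of_mem _ ⟨s, rfl⟩
  · exact mem_closure_of_tendsto htend
      (Eventually.of_forall fun s => ⟨_, ⟨s, rfl⟩, rfl⟩)
  · have h := not_tendsto_mean_norm_dyadicBumps_pow he one_ne_zero
    simp only [pow_one] at h
    exact h
end

section
/- Let H be a Hilbert space, (e_n)_{n∈ℤ} an orthonormal family in H, and let f : ℝ → H be the tent function determined by f(n) = e_n for n ∈ ℤ, f(n ± 1/2) = 0, and f affine on each interval [n − 1/2, n] and [n, n + 1/2]. Then for every q ≥ 1 and all real numbers c_1 < c_2 < ... < c_q with c_{j+1} − c_j > 1 for 1 ≤ j < q, one has sup_{t∈ℝ} ‖(1/q) Σ_{j=1}^{q} f(c_j + t)‖ ≤ 1/√q. -/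
open Filter Topology

/-- The tent function associated to an orthonormal family `(e n)_{n ∈ ℤ}`:
`f t = max 0 (1 - 2|t - n|) • e n` for `t ∈ [n - 1/2, n + 1/2)` (note `round t = n`
precisely for such `t`); it satisfies `f n = e n`, `f (n ± 1/2) = 0` and is affine on
each interval `[n - 1/2, n]` and `[n, n + 1/2]`. -/
noncomputable def tentFun {H : Type*} [NormedAddCommGroup H] [InnerProductSpace ℂ H]
    (e : ℤ → H) (t : ℝ) : H :=
  (max 0 (1 - 2 * |t - (round t : ℝ)|)) • e (round t)

lemma norm_tentFun_le_one {H : Type*} [NormedAddCommGroup H] [InnerProductSpace ℂ H]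
    {e : ℤ → H} (he : Orthonormal ℂ e) (t : ℝ) : ‖tentFun e t‖ ≤ 1 := by
  rw [tentFun, norm_smul, he.norm_eq_one, mul_one, Real.norm_of_nonneg (le_max_left _ _)]
  exact max_le zero_le_one (by linarith [abs_nonneg (t - (round t : ℝ))])

lemma inner_tentFun_eq_zero {H : Type*} [NormedAddCommGroup H] [InnerProductSpace ℂ H]
    {e : ℤ → H} (he : Orthonormal ℂ e) {s t : ℝ} (hst : 1 < |s - t|) :
    inner ℂ (tentFun e s) (tentFun e t) = 0 := by
  have hne : round s ≠ round t := by
    intro h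
    have hs := abs_sub_round s
    have ht := abs_sub_round t
    rw [h] at hs
    have := abs_sub_le s (round t : ℝ) t
    rw [abs_sub_comm (round t : ℝ) t] at this
    linarith
  simp only [tentFun, ← Complex.coe_smul, inner_smul_left, inner_smul_right, he.inner_eq_zero hne,
    mul_zero]

lemma norm_sum_le_sqrt_card_of_pairwise_inner_eq_zero {H ι : Type*} [NormedAddCommGroup H]
    [InnerProductSpace ℂ H] (s : Finset ι) (x : ι → H) (hx : ∀ i ∈ s, ‖x i‖ ≤ 1)
    (horth : (s : Set ι).Pairwise fun i j => inner ℂ (x i) (x j) = 0) :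
    ‖∑ i ∈ s, x i‖ ≤ √(s.card : ℝ) := by
  apply Real.le_sqrt_of_sq_le
  classical
  induction s using Finset.induction_on with
  | empty => simp
  | insert a s ha ih =>
    have hrest := ih (fun i hi => hx i (Finset.mem_insert_of_mem hi))
      (horth.mono (by simp))
    have hinner : inner ℂ (x a) (∑ i ∈ s, x i) = 0 := by
      rw [inner_sum]
      refine Finset.sum_eq_zero fun i hi => horth (by simp) (by simp [hi]) ?_
      rintro rfl
      exact ha hi
    have hpyth := norm_add_sq_eq_norm_sq_add_norm_sq_of_inner_eq_zero _ _ hinner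
    have hone := hx a (Finset.mem_insert_self a s)
    rw [Finset.sum_insert ha, Finset.card_insert_of_notMem ha]
    push_cast
    nlinarith [norm_nonneg (x a)]

/-- For the tent function `f` of an orthonormal family `(e n)_{n ∈ ℤ}` in a Hilbert space
and real numbers `c 0 < c 1 < ⋯ < c (q-1)` with consecutive gaps `> 1`, one has
`sup_t ‖(1/q) ∑_j f (c j + t)‖ ≤ 1/√q`. -/
theorem tentFun_convex_combination_sup_le
    {H : Type*} [NormedAddCommGroup H] [InnerProductSpace ℂ H] [CompleteSpace H]
    (e : ℤ → H) (he : Orthonormal ℂ e)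
    (q : ℕ) (hq : 1 ≤ q) (c : ℕ → ℝ)
    (hmono : ∀ i j, i < j → j < q → c i < c j)
    (hgap : ∀ j, j + 1 < q → c (j + 1) - c j > 1) :
    ∀ t : ℝ, ‖(q : ℝ)⁻¹ • ∑ j ∈ Finset.range q, tentFun e (c j + t)‖ ≤ 1 / Real.sqrt q := by
  intro t
  have hlt : ∀ i j, i < j → j < q → 1 < |(c i + t) - (c j + t)| := by
    intro i j hij hj
    obtain ⟨k, rfl⟩ : ∃ k, j = k + 1 := ⟨j - 1, by omega⟩
    have hik : c i ≤ c k := by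
      rcases (Nat.lt_succ_iff.mp hij).eq_or_lt with rfl | h
      · exact le_rfl
      · exact (hmono i k h (by omega)).le
    rw [abs_sub_comm, lt_abs]
    exact Or.inl (by linarith [hgap k hj])
  have hsum := norm_sum_le_sqrt_card_of_pairwise_inner_eq_zero (Finset.range q)
    (fun j => tentFun e (c j + t)) (fun j _ => norm_tentFun_le_one he _) (by
      intro i hi j hj hij
      simp only [Finset.coe_range, Set.mem_Iio] at hi hj
      refine inner_tentFun_eq_zero he ?_
      rcases hij.lt_or_gt with h | h
      · exact hlt i j h hj
      · rw [abs_sub_comm]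
        exact hlt j i h hi)
  rw [Finset.card_range] at hsum
  have hq0 : (0 : ℝ) < q := by exact_mod_cast hq
  rw [norm_smul, norm_inv, Real.norm_of_nonneg hq0.le, ← Real.sqrt_div_self', div_eq_inv_mul]
  gcongr
end

section
/- Let H be a Hilbert space, (e_n)_{n∈ℤ} an orthonormal family in H, and f : ℝ → H the tent function (f(n) = e_n, f(n ± 1/2) = 0, affine in between). Then for every sequence (c_k)_{k∈ℕ} of real numbers with c_{k+1} − c_k > 1 for all k, the translates f_{c_k} (where f_{c_k}(t) = f(c_k + t)) converge to 0 in the weak topology of C_b(ℝ,H). -/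
open BoundedContinuousFunction Filter Topology

/-- A sequence satisfying an upper `ℓ²`-estimate converges weakly to zero. -/
theorem tendsto_clm_zero_of_norm_sum_sq_le {E : Type*} [SeminormedAddCommGroup E]
    [NormedSpace ℂ E] {x : ℕ → E}
    (hx : ∀ (s : Finset ℕ) (a : ℕ → ℂ), ‖∑ k ∈ s, a k • x k‖ ^ 2 ≤ ∑ k ∈ s, ‖a k‖ ^ 2)
    (φ : E →L[ℂ] ℂ) : Tendsto (fun k => φ (x k)) atTop (𝓝 0) := by
  have bound (s : Finset ℕ) : ∑ k ∈ s, ‖φ (x k)‖ ^ 2 ≤ ‖φ‖ ^ 2 := by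
    set S := ∑ k ∈ s, ‖φ (x k)‖ ^ 2 with hS
    have hS0 : 0 ≤ S := Finset.sum_nonneg fun _ _ => sq_nonneg _
    set y := ∑ k ∈ s, (starRingEnd ℂ) (φ (x k)) • x k with hy
    have hφy : φ y = (S : ℂ) := by
      simp only [hy, hS, map_sum, map_smul, smul_eq_mul, Complex.conj_mul', Complex.ofReal_sum,
        Complex.ofReal_pow]
    have hSy : S ≤ ‖φ‖ * ‖y‖ := by
      simpa [hφy, abs_of_nonneg hS0] using φ.le_opNorm y
    have hyS : ‖y‖ ^ 2 ≤ S := by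
      simpa [hS] using hx s fun k => (starRingEnd ℂ) (φ (x k))
    rcases hS0.eq_or_lt with h | h
    · rw [← h]; positivity
    · refine le_of_mul_le_mul_right ?_ h
      calc S * S ≤ (‖φ‖ * ‖y‖) * (‖φ‖ * ‖y‖) := by gcongr
        _ = ‖φ‖ ^ 2 * ‖y‖ ^ 2 := by ring
        _ ≤ ‖φ‖ ^ 2 * S := by gcongr
  have hsq := (summable_of_sum_le (fun _ => sq_nonneg _) bound).tendsto_atTop_zero
  rw [tendsto_zero_iff_norm_tendsto_zero]
  simpa [Real.sqrt_sq] using hsq.sqrt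

theorem Orthonormal.norm_sum_smul_sq {ι H : Type*} [NormedAddCommGroup H]
    [InnerProductSpace ℂ H] {v : ι → H} (hv : Orthonormal ℂ v) (s : Finset ι) (a : ι → ℂ) :
    ‖∑ i ∈ s, a i • v i‖ ^ 2 = ∑ i ∈ s, ‖a i‖ ^ 2 := by
  have h := hv.inner_sum a a s
  rw [inner_self_eq_norm_sq_to_K] at h
  simp only [Complex.conj_mul'] at h
  apply Complex.ofReal_injective
  push_cast
  exact h

theorem round_lt_round_of_add_one_le {x y : ℝ} (h : x + 1 ≤ y) : round x < round y := by
  rw [round_eq, round_eq, Int.lt_iff_add_one_le, Int.le_floor]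
  push_cast
  linarith [Int.floor_le (x + 1 / 2)]

/-- If `f` is the tent function of an orthonormal family `(e n)_{n ∈ ℤ}` in a Hilbert
space `H` and `(c k)` is a sequence of reals with `c (k+1) - c k > 1` for all `k`, then
the translates `f_{c k}` converge to `0` in the weak topology of `C_b(ℝ,H)`, i.e. under
every continuous linear functional on `C_b(ℝ,H)`. -/
theorem tentFun_translates_tendsto_weakly_zero
    {H : Type*} [NormedAddCommGroup H] [InnerProductSpace ℂ H] [CompleteSpace H]
    (e : ℤ → H) (he : Orthonormal ℂ e)
    (f : ℝ →ᵇ H) (hf : ∀ t, f t = tentFun e t)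
    (c : ℕ → ℝ) (hc : ∀ k, c (k + 1) - c k > 1) :
    ∀ φ : (ℝ →ᵇ H) →L[ℂ] ℂ,
      Tendsto (fun k => φ (translateBCF f (c k))) atTop (𝓝 0) := by
  have hnorm (s : Finset ℕ) (a : ℕ → ℂ) :
      ‖∑ k ∈ s, a k • translateBCF f (c k)‖ ^ 2 ≤ ∑ k ∈ s, ‖a k‖ ^ 2 := by
    rw [← Real.le_sqrt (norm_nonneg _) (Finset.sum_nonneg fun _ _ => sq_nonneg _),
      BoundedContinuousFunction.norm_le (Real.sqrt_nonneg _)]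
    intro t
    have hmono : StrictMono fun k => round (c k + t) :=
      strictMono_nat_of_lt_succ fun k => round_lt_round_of_add_one_le (by linarith [hc k])
    set r : ℕ → ℝ := fun k => max 0 (1 - 2 * |c k + t - (round (c k + t) : ℝ)|) with hr
    have hr0 (k : ℕ) : 0 ≤ r k := le_max_left _ _
    have hr1 (k : ℕ) : r k ≤ 1 :=
      max_le zero_le_one (by linarith [abs_nonneg (c k + t - (round (c k + t) : ℝ))])
    have heval : (∑ k ∈ s, a k • translateBCF f (c k)) t =
        ∑ k ∈ s, (a k * (r k : ℂ)) • (e ∘ fun k => round (c k + t)) k := by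
      simp [translateBCF, hf, tentFun, hr, mul_smul, BoundedContinuousFunction.sum_apply]
    refine Real.le_sqrt_of_sq_le ?_
    rw [heval, (he.comp _ hmono.injective).norm_sum_smul_sq]
    refine Finset.sum_le_sum fun k _ => ?_
    rw [norm_mul, Complex.norm_real, Real.norm_of_nonneg (hr0 k)]
    gcongr
    exact mul_le_of_le_one_right (norm_nonneg _) (hr1 k)
  exact tendsto_clm_zero_of_norm_sum_sq_le hnorm
end

section
/- Let H be a Hilbert space, (e_n)_{n∈ℤ} an orthonormal family in H, and f : ℝ → H the tent function (f(n) = e_n, f(n ± 1/2) = 0, affine in between). Then the orbit {f_s : s ∈ ℝ} (where f_s(t) = f(s+t)) is relatively compact in the weak topology of C_b(ℝ,H), and 0 lies in the closure of the orbit in the weak topology; that is, f ∈ EAP_0(ℝ,H). -/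
open BoundedContinuousFunction Filter Topology

/-- The profile `max 0 (1 - 2|t - round t|)` of the tent function equals `1 - 2|t - round t|`. -/
lemma tentFun_eq {H : Type*} [NormedAddCommGroup H] [InnerProductSpace ℂ H] (e : ℤ → H) (t : ℝ) :
    tentFun e t = ((1 - 2 * |t - round t| : ℝ) : ℂ) • e (round t) := by
  rw [tentFun, max_eq_right (by linarith [abs_sub_round t]), Complex.coe_smul]

lemma norm_tentFun {H : Type*} [NormedAddCommGroup H] [InnerProductSpace ℂ H] {e : ℤ → H}
    (he : Orthonormal ℂ e) (t : ℝ) : ‖tentFun e t‖ = 1 - 2 * |t - round t| := by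
  rw [tentFun_eq, norm_smul, he.1, mul_one, Complex.norm_real, Real.norm_eq_abs,
    abs_of_nonneg (by linarith [abs_sub_round t])]

lemma norm_tentFun_le_of_round_ne {H : Type*} [NormedAddCommGroup H] [InnerProductSpace ℂ H]
    {e : ℤ → H} (he : Orthonormal ℂ e) {t u : ℝ} (h : round t ≠ round u) :
    ‖tentFun e t‖ ≤ 2 * |t - u| := by
  rw [norm_tentFun he]
  have h1 : (1 : ℝ) ≤ |(round t : ℝ) - round u| := by
    exact_mod_cast Int.one_le_abs (sub_ne_zero.2 h)
  have h2 := abs_sub_round u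
  have h3 : |(round t : ℝ) - round u| ≤ |t - round t| + |t - u| + |u - round u| := by
    have := abs_add_three (round t - t) (t - u) (u - round u)
    rwa [abs_sub_comm (round t : ℝ) t, sub_add_sub_cancel, sub_add_sub_cancel] at this
  linarith

lemma norm_tentFun_sub_le {H : Type*} [NormedAddCommGroup H] [InnerProductSpace ℂ H]
    {e : ℤ → H} (he : Orthonormal ℂ e) (t u : ℝ) :
    ‖tentFun e t - tentFun e u‖ ≤ 4 * |t - u| := by
  by_cases h : round t = round u
  · rw [tentFun_eq, tentFun_eq, h, ← sub_smul, norm_smul, he.1, mul_one, ← Complex.ofReal_sub,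
      Complex.norm_real, Real.norm_eq_abs]
    have h1 := abs_abs_sub_abs_le_abs_sub (u - round u) (t - round u)
    rw [sub_sub_sub_cancel_right, abs_sub_comm u t] at h1
    rw [show 1 - 2 * |t - round u| - (1 - 2 * |u - round u|)
      = 2 * (|u - round u| - |t - round u|) by ring, abs_mul, abs_two]
    linarith [abs_nonneg (t - u)]
  · have h1 := norm_tentFun_le_of_round_ne he h
    have h2 := norm_tentFun_le_of_round_ne he (Ne.symm h)
    rw [abs_sub_comm u t] at h2
    linarith [norm_sub_le (tentFun e t) (tentFun e u)]

lemma continuous_translateBCF {H : Type*} [NormedAddCommGroup H] [InnerProductSpace ℂ H]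
    {e : ℤ → H} (he : Orthonormal ℂ e) {f : ℝ →ᵇ H} (hf : ∀ t, f t = tentFun e t) :
    Continuous (translateBCF f) := by
  refine (LipschitzWith.of_dist_le_mul (K := 4) fun s u => ?_).continuous
  refine (dist_le (by positivity)).2 fun t => ?_
  have := norm_tentFun_sub_le he (s + t) (u + t)
  rw [add_sub_add_right_eq_sub] at this
  simpa [translateBCF, hf, dist_eq_norm] using this

/-- Translates of the tent function by points at mutual distance greater than `1` satisfy an upper
`ℓ²` estimate. -/
lemma norm_sum_smul_translateBCF_sq_le_s7 {H ι : Type*} [NormedAddCommGroup H]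
    [InnerProductSpace ℂ H] {e : ℤ → H} (he : Orthonormal ℂ e) {f : ℝ →ᵇ H}
    (hf : ∀ t, f t = tentFun e t) {s : ι → ℝ} (hs : Pairwise fun i j => 1 < |s i - s j|)
    (F : Finset ι) (a : ι → ℂ) :
    ‖∑ i ∈ F, a i • translateBCF f (s i)‖ ^ 2 ≤ ∑ i ∈ F, ‖a i‖ ^ 2 := by
  have h0 : 0 ≤ ∑ i ∈ F, ‖a i‖ ^ 2 := Finset.sum_nonneg fun i _ => by positivity
  rw [← Real.le_sqrt (norm_nonneg _) h0, norm_le (Real.sqrt_nonneg _)]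
  intro t
  rw [Real.le_sqrt (norm_nonneg _) h0]
  have hinj : Function.Injective fun i => round (s i + t) := by
    intro i j hij
    by_contra hne
    have h1 := abs_le.1 (abs_sub_round (s i + t))
    have h2 := abs_le.1 (abs_sub_round (s j + t))
    have h3 : (round (s i + t) : ℝ) = round (s j + t) := by exact_mod_cast hij
    refine (hs hne).not_ge (abs_le.2 ⟨?_, ?_⟩) <;> linarith [h1.1, h1.2, h2.1, h2.2]
  have horth := he.comp _ hinj
  have hsum : (∑ i ∈ F, a i • translateBCF f (s i)) t
      = ∑ i ∈ F, (a i * ((1 - 2 * |s i + t - round (s i + t)| : ℝ) : ℂ)) •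
          (e ∘ fun i => round (s i + t)) i := by
    simp only [coe_sum, Finset.sum_apply, coe_smul, Function.comp_apply, mul_smul, ← tentFun_eq]
    exact Finset.sum_congr rfl fun i _ => congrArg (a i • ·) (hf (s i + t))
  have key := horth.inner_sum (fun i => a i * ((1 - 2 * |s i + t - round (s i + t)| : ℝ) : ℂ))
    (fun i => a i * ((1 - 2 * |s i + t - round (s i + t)| : ℝ) : ℂ)) F
  rw [← hsum, inner_self_eq_norm_sq_to_K] at key
  have key' : ‖(∑ i ∈ F, a i • translateBCF f (s i)) t‖ ^ 2
      = ∑ i ∈ F, ‖a i * ((1 - 2 * |s i + t - round (s i + t)| : ℝ) : ℂ)‖ ^ 2 := by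
    simp only [RCLike.conj_mul] at key
    exact_mod_cast key
  rw [key']
  refine Finset.sum_le_sum fun i _ => ?_
  have hb := abs_sub_round (s i + t)
  rw [norm_mul, Complex.norm_real, Real.norm_eq_abs, abs_of_nonneg (by linarith)]
  have hb' := abs_nonneg (s i + t - round (s i + t))
  exact pow_le_pow_left₀ (mul_nonneg (norm_nonneg _) (by linarith))
    (mul_le_of_le_one_right (norm_nonneg _) (by linarith)) 2

/-- Bessel's inequality for a functional evaluated at separated translates. -/
lemma sum_norm_apply_translateBCF_sq_le {H ι : Type*} [NormedAddCommGroup H]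
    [InnerProductSpace ℂ H] {e : ℤ → H} (he : Orthonormal ℂ e) {f : ℝ →ᵇ H}
    (hf : ∀ t, f t = tentFun e t) {s : ι → ℝ} (hs : Pairwise fun i j => 1 < |s i - s j|)
    (F : Finset ι) (l : (ℝ →ᵇ H) →L[ℂ] ℂ) :
    ∑ i ∈ F, ‖l (translateBCF f (s i))‖ ^ 2 ≤ ‖l‖ ^ 2 := by
  set S := ∑ i ∈ F, ‖l (translateBCF f (s i))‖ ^ 2 with hS
  have hS0 : 0 ≤ S := Finset.sum_nonneg fun i _ => by positivity
  set v := ∑ i ∈ F, (starRingEnd ℂ) (l (translateBCF f (s i))) • translateBCF f (s i) with hv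
  have hlv : l v = (S : ℂ) := by
    simp [hv, hS, map_sum, RCLike.conj_mul]
  have hvn : ‖v‖ ^ 2 ≤ S := by
    simpa using norm_sum_smul_translateBCF_sq_le_s7 he hf hs F
      (fun i => (starRingEnd ℂ) (l (translateBCF f (s i))))
  have h1 : S ≤ ‖l‖ * ‖v‖ := by
    have := l.le_opNorm v
    rwa [hlv, Complex.norm_real, Real.norm_eq_abs, abs_of_nonneg hS0] at this
  have h2 : S * S ≤ ‖l‖ ^ 2 * S :=
    calc S * S ≤ (‖l‖ * ‖v‖) * (‖l‖ * ‖v‖) := mul_self_le_mul_self hS0 h1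
      _ = ‖l‖ ^ 2 * ‖v‖ ^ 2 := by ring
      _ ≤ ‖l‖ ^ 2 * S := by gcongr
  rcases hS0.eq_or_lt with h | h
  · rw [← h]; positivity
  · exact le_of_mul_le_mul_right h2 h

lemma tendsto_apply_translateBCF_cocompact {H : Type*} [NormedAddCommGroup H]
    [InnerProductSpace ℂ H] {e : ℤ → H} (he : Orthonormal ℂ e) {f : ℝ →ᵇ H}
    (hf : ∀ t, f t = tentFun e t) (l : (ℝ →ᵇ H) →L[ℂ] ℂ) :
    Tendsto (fun s => l (translateBCF f s)) (cocompact ℝ) (𝓝 0) := by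
  rw [Metric.tendsto_nhds]
  intro ε hε
  by_contra hcon
  have hfreq : ∃ᶠ s in cocompact ℝ, ε ≤ ‖l (translateBCF f s)‖ :=
    (not_eventually.1 hcon).mono fun s hs => by simpa using hs
  have : Std.Symm fun x y : ℝ => 1 < |x - y| := ⟨fun x y h => by rwa [abs_sub_comm]⟩
  obtain ⟨s, hsε, hs⟩ := exists_seq_of_forall_finset_exists'
    (fun s => ε ≤ ‖l (translateBCF f s)‖) (fun x y : ℝ => 1 < |x - y|) fun F _ => by
      have hK : IsCompact (⋃ x ∈ F, Metric.closedBall x 1) :=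
        F.isCompact_biUnion fun x _ => isCompact_closedBall x 1
      obtain ⟨y, hy, hyK⟩ := (hfreq.and_eventually hK.compl_mem_cocompact).exists
      refine ⟨y, hy, fun x hx => ?_⟩
      by_contra hxy
      refine hyK (Set.mem_biUnion hx ?_)
      rw [Metric.mem_closedBall, Real.dist_eq, abs_sub_comm]
      exact not_lt.1 hxy
  obtain ⟨N, hN⟩ := exists_nat_gt (‖l‖ ^ 2 / ε ^ 2)
  rw [div_lt_iff₀ (by positivity)] at hN
  have h1 := sum_norm_apply_translateBCF_sq_le he hf hs (Finset.range N) l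
  have h2 : (N : ℝ) * ε ^ 2 ≤ ∑ i ∈ Finset.range N, ‖l (translateBCF f (s i))‖ ^ 2 := by
    simpa using Finset.card_nsmul_le_sum (Finset.range N)
      (fun i => ‖l (translateBCF f (s i))‖ ^ 2) (ε ^ 2)
      fun i _ => by have := hsε i; gcongr
  linarith

/-- The tent function of an orthonormal family `(e n)_{n ∈ ℤ}` in a Hilbert space `H`
belongs to `EAP₀(ℝ,H)`: its orbit `{f_s : s ∈ ℝ}` is relatively compact in the weak
topology of `C_b(ℝ,H)` and `0` lies in the weak closure of the orbit. -/
theorem tentFun_mem_EAP0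
    {H : Type*} [NormedAddCommGroup H] [InnerProductSpace ℂ H] [CompleteSpace H]
    (e : ℤ → H) (he : Orthonormal ℂ e)
    (f : ℝ →ᵇ H) (hf : ∀ t, f t = tentFun e t) :
    IsCompact (closure ((toWeakSpace ℂ (ℝ →ᵇ H)) '' Set.range (translateBCF f))) ∧
    (0 : WeakSpace ℂ (ℝ →ᵇ H)) ∈
      closure ((toWeakSpace ℂ (ℝ →ᵇ H)) '' Set.range (translateBCF f)) := by
  have hcont : Continuous fun s => toWeakSpace ℂ (ℝ →ᵇ H) (translateBCF f s) :=
    (toWeakSpaceCLM ℂ (ℝ →ᵇ H)).continuous.comp (continuous_translateBCF he hf)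
  have hlim : Tendsto (fun s => toWeakSpace ℂ (ℝ →ᵇ H) (translateBCF f s)) (cocompact ℝ)
      (𝓝 0) := by
    refine (WeakBilin.tendsto_iff_forall_eval_tendsto (topDualPairing ℂ (ℝ →ᵇ H)).flip
      (fun x y h => SeparatingDual.eq_iff_forall_dual_eq.2 (DFunLike.congr_fun h))).2 fun l => ?_
    have h := tendsto_apply_translateBCF_cocompact he hf l
    rw [← map_zero l] at h
    exact h
  rw [← Set.range_comp]
  constructor
  · exact (hlim.isCompact_insert_range_of_cocompact hcont).closure_of_subset
      (Set.subset_insert _ _)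
  · exact mem_closure_of_tendsto hlim (Eventually.of_forall fun s => Set.mem_range_self s)
end

section
/- For every infinite-dimensional complex Hilbert space H there exists a bounded, uniformly continuous function f : ℝ → H whose orbit {f_s : s ∈ ℝ} is relatively compact in the weak topology of C_b(ℝ,H) (so f is Eberlein almost periodic), but f is not pseudo almost periodic: there exist no g ∈ AP(ℝ,H) and h ∈ C_b(ℝ,H) with lim_{T→∞} (1/(2T)) ∫_{−T}^{T} ‖h(t)‖ dt = 0 such that f = g + h. -/
open BoundedContinuousFunction Filter Topology

/-- `g` is (Bohr) almost periodic: its orbit is relatively compact in the norm topology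
of `C_b(ℝ,X)`. -/
def IsAP {X : Type*} [SeminormedAddCommGroup X] (g : ℝ →ᵇ X) : Prop :=
  IsCompact (closure (Set.range (translateBCF g)))

/-- If finitely many translates of `‖h‖` have a sum bounded below near `+∞`, then `h` does not
have mean zero. -/
lemma not_tendsto_mean_zero {X : Type*} [SeminormedAddCommGroup X] (h : ℝ →ᵇ X) (F : Finset ℝ)
    {c : ℝ} (hc : 0 < c) (hF : ∀ᶠ s in atTop, c ≤ ∑ a ∈ F, ‖h (s + a)‖) :
    ¬ Tendsto (fun T : ℝ => (1 / (2 * T)) * ∫ t in (-T)..T, ‖h t‖) atTop (𝓝 0) := by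
  intro hlim
  obtain ⟨R₀, hR₀⟩ := eventually_atTop.1 hF
  set R := max R₀ 0
  have hR0 : 0 ≤ R := le_max_right _ _
  have hR : ∀ s, R ≤ s → c ≤ ∑ a ∈ F, ‖h (s + a)‖ := fun s hs =>
    hR₀ s ((le_max_left _ _).trans hs)
  set A := ∑ a ∈ F, |a|
  have hA : ∀ a ∈ F, |a| ≤ A := fun a ha =>
    Finset.single_le_sum (f := fun a : ℝ => |a|) (fun _ _ => abs_nonneg _) ha
  have hA0 : 0 ≤ A := Finset.sum_nonneg fun _ _ => abs_nonneg _
  have hcont : Continuous fun t => ‖h t‖ := h.continuous.norm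
  have hInt : ∀ a b, IntervalIntegrable (fun t => ‖h t‖) MeasureTheory.volume a b :=
    fun a b => hcont.intervalIntegrable a b
  have key : ∀ S, R + A ≤ S → c * (S - A - R) ≤ F.card * ∫ t in (-S)..S, ‖h t‖ := by
    intro S hS
    have hFInt : ∀ a ∈ F, IntervalIntegrable (fun t => ‖h (t + a)‖) MeasureTheory.volume
        R (S - A) := fun a _ =>
      (hcont.comp (continuous_id.add continuous_const)).intervalIntegrable _ _
    calc c * (S - A - R) = ∫ _ in R..(S - A), c := by
          rw [intervalIntegral.integral_const, smul_eq_mul, mul_comm]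
      _ ≤ ∫ t in R..(S - A), ∑ a ∈ F, ‖h (t + a)‖ := by
          refine intervalIntegral.integral_mono_on (by linarith) (by simp) ?_
            fun t ht => hR t ht.1
          exact (continuous_finsetSum _ fun a _ =>
            hcont.comp (continuous_id.add continuous_const)).intervalIntegrable _ _
      _ = ∑ a ∈ F, ∫ t in R..(S - A), ‖h (t + a)‖ :=
          intervalIntegral.integral_finsetSum hFInt
      _ ≤ ∑ a ∈ F, ∫ t in (-S)..S, ‖h t‖ := by
          refine Finset.sum_le_sum fun a ha => ?_
          rw [intervalIntegral.integral_comp_add_right (fun t => ‖h t‖)]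
          have := abs_le.1 (hA a ha)
          exact intervalIntegral.integral_mono_interval (by linarith) (by linarith)
            (by linarith) (Eventually.of_forall fun _ => norm_nonneg _) (hInt _ _)
      _ = F.card * ∫ t in (-S)..S, ‖h t‖ := by rw [Finset.sum_const, nsmul_eq_mul]
  have hε : 0 < c / (4 * (F.card + 1)) := by positivity
  obtain ⟨S, hS1, hS2⟩ := ((hlim.eventually_lt_const hε).and
    (eventually_gt_atTop (2 * (A + R)))).exists
  have hSpos : 0 < S := by linarith
  have h1 : (∫ t in (-S)..S, ‖h t‖) ≤ c / (4 * (F.card + 1)) * (2 * S) := by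
    rw [one_div, inv_mul_eq_div, div_lt_iff₀ (by positivity)] at hS1
    exact hS1.le
  have h2 : (F.card : ℝ) * (c / (4 * (F.card + 1)) * (2 * S)) ≤ c * S / 2 := by
    rw [div_mul_eq_mul_div, mul_div_assoc', div_le_div_iff₀ (by positivity) (by positivity)]
    nlinarith [mul_pos hc hSpos]
  have h3 := key S (by linarith)
  have h4 := mul_le_mul_of_nonneg_left h1 (Nat.cast_nonneg (α := ℝ) F.card)
  nlinarith [mul_lt_mul_of_pos_left hS2 hc]

lemma continuous_translateBCF_s9 {X : Type*} [SeminormedAddCommGroup X] {f : ℝ →ᵇ X} (hf : UniformContinuous f) :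
    Continuous (translateBCF f) := by
  refine Metric.continuous_iff.2 fun s ε hε => ?_
  obtain ⟨δ, hδ, h⟩ := Metric.uniformContinuous_iff.1 hf (ε / 2) (half_pos hε)
  refine ⟨δ, hδ, fun r hr => ?_⟩
  refine lt_of_le_of_lt ?_ (half_lt_self hε)
  refine (BoundedContinuousFunction.dist_le (half_pos hε).le).2 fun t => ?_
  exact (h (by simpa using hr : dist (r + t) (s + t) < δ)).le

section Hilbert

variable {H : Type*} [NormedAddCommGroup H] [InnerProductSpace ℂ H]

/-- A nonzero value of an almost periodic function recurs, up to one of finitely many shifts. -/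
lemma IsAP.exists_le_sum_norm_inner {g : ℝ →ᵇ H} (hg : IsAP g) {t₀ : ℝ} (h0 : g t₀ ≠ 0) :
    ∃ (F : Finset ℝ) (c : ℝ), 0 < c ∧ ∀ s, c ≤ ∑ a ∈ F, ‖inner ℂ (g t₀) (g (s + a))‖ := by
  classical
  have hx : 0 < ‖g t₀‖ := norm_pos_iff.2 h0
  obtain ⟨K, hK, hKfin, hcov⟩ :=
    exists_finite_cover_balls_of_isCompact_closure hg (half_pos hx)
  have hK' : ∀ y ∈ K, ∃ s, translateBCF g s = y := fun y hy => hK hy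
  choose! p hp using hK'
  refine ⟨hKfin.toFinset.image fun y => t₀ - p y, ‖g t₀‖ ^ 2 / 2, by positivity, fun s => ?_⟩
  obtain ⟨y, hyK, hy⟩ := Set.mem_iUnion₂.1 (hcov ⟨s, rfl⟩)
  have hd : ‖g (s + (t₀ - p y)) - g t₀‖ < ‖g t₀‖ / 2 := by
    have := (BoundedContinuousFunction.dist_coe_le_dist (t₀ - p y)).trans_lt (Metric.mem_ball.1 hy)
    have hyt : g (p y + (t₀ - p y)) = y (t₀ - p y) := DFunLike.congr_fun (hp y hyK) (t₀ - p y)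
    rw [add_sub_cancel] at hyt
    rwa [← hyt, dist_eq_norm] at this
  have h1 : ‖inner ℂ (g t₀) (g (s + (t₀ - p y)) - g t₀)‖ ≤ ‖g t₀‖ * (‖g t₀‖ / 2) :=
    (norm_inner_le_norm _ _).trans (by gcongr)
  have h2 : ‖inner ℂ (g t₀) (g t₀)‖ = ‖g t₀‖ ^ 2 := by
    rw [inner_self_eq_norm_sq_to_K]; simp
  have h3 : ‖g t₀‖ ^ 2 / 2 ≤ ‖inner ℂ (g t₀) (g (s + (t₀ - p y)))‖ := by
    have := norm_sub_norm_le (inner ℂ (g t₀) (g t₀))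
      (-inner ℂ (g t₀) (g (s + (t₀ - p y)) - g t₀))
    rw [sub_neg_eq_add, ← inner_add_right, add_sub_cancel, norm_neg] at this
    nlinarith
  exact h3.trans (Finset.single_le_sum
    (f := fun a => ‖inner ℂ (g t₀) (g (s + a))‖) (fun _ _ => norm_nonneg _)
    (Finset.mem_image_of_mem _ (hKfin.mem_toFinset.2 hyK)))

/-- If `f` has orthogonal values at distance at least `2`, its translates go weakly to zero. -/
lemma tendsto_dual_translate_zero (f : ℝ →ᵇ H) (hf1 : ∀ t, ‖f t‖ ≤ 1)
    (hf : ∀ s t, 2 ≤ |s - t| → inner ℂ (f s) (f t) = 0) (L : StrongDual ℂ (ℝ →ᵇ H)) :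
    Tendsto (fun s => L (translateBCF f s)) (cocompact ℝ) (𝓝 0) := by
  classical
  have bound : ∀ S : Finset ℝ, (∀ s ∈ S, ∀ t ∈ S, s ≠ t → 2 ≤ |s - t|) →
      ∑ s ∈ S, ‖L (translateBCF f s)‖ ^ 2 ≤ ‖L‖ ^ 2 := by
    intro S hS
    set z : ℝ → ℂ := fun s => L (translateBCF f s)
    set Q := ∑ s ∈ S, ‖z s‖ ^ 2
    have hQ0 : 0 ≤ Q := Finset.sum_nonneg fun _ _ => by positivity
    set φ : ℝ →ᵇ H := ∑ s ∈ S, (starRingEnd ℂ (z s)) • translateBCF f s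
    have hLφ : L φ = (Q : ℂ) := by
      simp only [φ, Q, map_sum, map_smul, smul_eq_mul, Complex.ofReal_sum]
      refine Finset.sum_congr rfl fun s _ => ?_
      rw [Complex.ofReal_pow, ← Complex.conj_mul']
    have hφ : ‖φ‖ ≤ √Q := by
      refine (BoundedContinuousFunction.norm_le (Real.sqrt_nonneg _)).2 fun t => ?_
      refine Real.le_sqrt_of_sq_le ?_
      have e : φ t = ∑ s ∈ S, (starRingEnd ℂ (z s)) • f (s + t) := by
        simp [φ, translateBCF]
      have hpy : ‖φ t‖ ^ 2 = ∑ s ∈ S, ‖z s‖ ^ 2 * ‖f (s + t)‖ ^ 2 := by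
        have : ((‖φ t‖ ^ 2 : ℝ) : ℂ) = ((∑ s ∈ S, ‖z s‖ ^ 2 * ‖f (s + t)‖ ^ 2 : ℝ) : ℂ) := by
          rw [Complex.ofReal_pow, ← RCLike.ofReal_eq_complex_ofReal,
            ← inner_self_eq_norm_sq_to_K (𝕜 := ℂ), e, sum_inner]
          push_cast
          refine Finset.sum_congr rfl fun s hs => ?_
          rw [inner_sum, Finset.sum_eq_single s]
          · rw [inner_smul_left, inner_smul_right, inner_self_eq_norm_sq_to_K, ← mul_assoc,
              Complex.conj_conj, Complex.mul_conj']
            simp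
          · intro r hr hrs
            rw [inner_smul_left, inner_smul_right, hf _ _ (by
              simpa using hS s hs r hr hrs.symm), mul_zero, mul_zero]
          · exact fun h => absurd hs h
        exact_mod_cast this
      rw [hpy]
      refine Finset.sum_le_sum fun s _ => mul_le_of_le_one_right (by positivity) ?_
      exact pow_le_one₀ (norm_nonneg _) (hf1 _)
    have h1 : Q ≤ ‖L‖ * √Q := by
      calc Q = ‖L φ‖ := by rw [hLφ, Complex.norm_real, Real.norm_of_nonneg hQ0]
        _ ≤ ‖L‖ * ‖φ‖ := L.le_opNorm φ
        _ ≤ ‖L‖ * √Q := by gcongr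
    have h2 := Real.sq_sqrt hQ0
    have h3 := Real.sqrt_nonneg Q
    rcases h3.eq_or_lt with h | h
    · rw [← h2, ← h, zero_pow two_ne_zero]; positivity
    · have : √Q ≤ ‖L‖ := le_of_mul_le_mul_right (by nlinarith) h
      rw [← h2]; gcongr
  rw [Metric.tendsto_nhds]
  intro ε hε
  by_contra hcon
  have far : ∀ R : ℝ, ∃ s, R < |s| ∧ ε ≤ ‖L (translateBCF f s)‖ := by
    intro R
    by_contra! hR
    refine hcon ?_
    filter_upwards [(isCompact_closedBall (0 : ℝ) R).compl_mem_cocompact] with s hs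
    rw [dist_zero_right]
    exact hR s (by simpa using hs)
  have build : ∀ n : ℕ, ∃ S : Finset ℝ, S.card = n ∧
      (∀ s ∈ S, ∀ t ∈ S, s ≠ t → 2 ≤ |s - t|) ∧ ∀ s ∈ S, ε ≤ ‖L (translateBCF f s)‖ := by
    intro n
    induction n with
    | zero => exact ⟨∅, by simp⟩
    | succ n ih =>
      obtain ⟨S, hn, hsep, hL⟩ := ih
      obtain ⟨r, hr, hrL⟩ := far (∑ a ∈ S, |a| + 2)
      have hrs : ∀ s ∈ S, 2 ≤ |r - s| := fun s hs => by
        have h1 : |s| ≤ ∑ a ∈ S, |a| :=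
          Finset.single_le_sum (f := fun a : ℝ => |a|) (fun _ _ => abs_nonneg _) hs
        have h2 := abs_sub_abs_le_abs_sub r s
        linarith
      have hrS : r ∉ S := fun h => by have := hrs r h; norm_num at this
      refine ⟨insert r S, by rw [Finset.card_insert_of_notMem hrS, hn], ?_, ?_⟩
      · intro s hs t ht hst
        rcases Finset.mem_insert.1 hs with hs | hs <;>
          rcases Finset.mem_insert.1 ht with ht | ht
        · exact absurd (hs.trans ht.symm) hst
        · rw [hs]; exact hrs t ht
        · rw [ht, abs_sub_comm]; exact hrs s hs
        · exact hsep s hs t ht hst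
      · simpa using ⟨hrL, hL⟩
  obtain ⟨n, hn⟩ := exists_nat_gt (‖L‖ ^ 2 / ε ^ 2)
  obtain ⟨S, hcard, hsep, hL⟩ := build n
  have h1 : n * ε ^ 2 ≤ ∑ s ∈ S, ‖L (translateBCF f s)‖ ^ 2 := by
    rw [← hcard, ← nsmul_eq_mul]
    exact Finset.card_nsmul_le_sum _ _ _ fun s hs => pow_le_pow_left₀ hε.le (hL s hs) 2
  rw [div_lt_iff₀ (by positivity)] at hn
  linarith [bound S hsep]

lemma isCompact_closure_weak_orbit {f : ℝ →ᵇ H} (hu : UniformContinuous f)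
    (hf : ∀ L : StrongDual ℂ (ℝ →ᵇ H),
      Tendsto (fun s => L (translateBCF f s)) (cocompact ℝ) (𝓝 0)) :
    IsCompact (closure ((toWeakSpace ℂ (ℝ →ᵇ H)) '' Set.range (translateBCF f))) := by
  have hc : Continuous fun s => toWeakSpace ℂ (ℝ →ᵇ H) (translateBCF f s) :=
    (toWeakSpaceCLM ℂ (ℝ →ᵇ H)).continuous.comp (continuous_translateBCF_s9 hu)
  have ht : Tendsto (fun s => toWeakSpace ℂ (ℝ →ᵇ H) (translateBCF f s)) (cocompact ℝ) (𝓝 0) := by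
    refine (WeakBilin.tendsto_iff_forall_eval_tendsto (B := (topDualPairing ℂ (ℝ →ᵇ H)).flip)
      fun x y hxy => ?_).2 fun L => ?_
    · by_contra hne
      obtain ⟨L, hL⟩ := SeparatingDual.exists_separating_of_ne (R := ℂ) hne
      exact hL (DFunLike.congr_fun hxy L)
    · have := hf L
      rw [← map_zero L] at this
      exact this
  refine (ht.isCompact_insert_range_of_cocompact hc).closure_of_subset ?_
  rw [← Set.range_comp]
  exact Set.subset_insert _ _

/-- A function with weakly vanishing translates that is bounded below in norm is not pseudo almost
periodic. -/
lemma not_pseudoAlmostPeriodic {f : ℝ →ᵇ H} {c : ℝ} (hc : 0 < c) (hfc : ∀ t, c ≤ ‖f t‖)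
    (hf : ∀ L : StrongDual ℂ (ℝ →ᵇ H),
      Tendsto (fun s => L (translateBCF f s)) (cocompact ℝ) (𝓝 0)) :
    ¬ ∃ (g h : ℝ →ᵇ H), IsAP g ∧
      Tendsto (fun T : ℝ => (1/(2*T)) * ∫ t in (-T)..T, ‖h t‖) atTop (𝓝 0) ∧ f = g + h := by
  rintro ⟨g, h, hg, hlim, rfl⟩
  by_cases hg0 : ∀ t, g t = 0
  · refine not_tendsto_mean_zero h {0} hc (Eventually.of_forall fun s => ?_) hlim
    simpa [hg0] using hfc s
  push Not at hg0
  obtain ⟨t₀, ht₀⟩ := hg0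
  have hx : 0 < ‖g t₀‖ := norm_pos_iff.2 ht₀
  obtain ⟨F, d, hd, hF⟩ := hg.exists_le_sum_norm_inner ht₀
  have hfx : ∀ a ∈ F, Tendsto (fun s => ‖inner ℂ (g t₀) ((g + h) (s + a))‖) atTop (𝓝 0) := by
    intro a _
    have := (hf (innerSL ℂ (g t₀) ∘L BoundedContinuousFunction.evalCLM ℂ a)).mono_left
      atTop_le_cocompact
    simpa [translateBCF, inner_add_right] using this.norm
  have hsum := tendsto_finsetSum F hfx
  rw [Finset.sum_const_zero] at hsum
  refine not_tendsto_mean_zero h F (c := d / 2 / ‖g t₀‖) (by positivity) ?_ hlim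
  filter_upwards [hsum.eventually_lt_const (half_pos hd)] with s hs
  rw [div_le_iff₀ hx, Finset.sum_mul]
  have : ∑ a ∈ F, ‖inner ℂ (g t₀) (g (s + a))‖ ≤
      ∑ a ∈ F, (‖inner ℂ (g t₀) ((g + h) (s + a))‖ + ‖h (s + a)‖ * ‖g t₀‖) := by
    refine Finset.sum_le_sum fun a _ => ?_
    have h1 := norm_sub_le (inner ℂ (g t₀) ((g + h) (s + a))) (inner ℂ (g t₀) (h (s + a)))
    rw [← inner_sub_right, BoundedContinuousFunction.add_apply, add_sub_cancel_right] at h1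
    have h2 := norm_inner_le_norm (𝕜 := ℂ) (g t₀) (h (s + a))
    rw [BoundedContinuousFunction.add_apply]
    linarith
  rw [Finset.sum_add_distrib] at this
  linarith [hF s]

lemma exists_orthonormal_int [CompleteSpace H] (hH : ¬ FiniteDimensional ℂ H) :
    ∃ e : ℤ → H, Orthonormal ℂ e := by
  obtain ⟨w, b, -⟩ := exists_hilbertBasis ℂ H
  have : Infinite w := by
    refine not_finite_iff_infinite.1 fun _ => hH ?_
    have := Fintype.ofFinite w
    exact b.toOrthonormalBasis.toBasis.finiteDimensional_of_finite
  exact ⟨_, b.orthonormal.comp _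
    ((Infinite.natEmbedding w).injective.comp Equiv.intEquivNat.injective)⟩

/-- The polygonal path running through the points `e n` at the integer times `n`. -/
noncomputable def polygonalPath (e : ℤ → H) (t : ℝ) : H :=
  ((1 - Int.fract t : ℝ) : ℂ) • e ⌊t⌋ + ((Int.fract t : ℝ) : ℂ) • e (⌊t⌋ + 1)

lemma polygonalPath_eq (e : ℤ → H) {t : ℝ} {n : ℤ} (h1 : n ≤ t) (h2 : t ≤ n + 1) :
    polygonalPath e t = e n + ((t - n : ℝ) : ℂ) • (e (n + 1) - e n) := by
  rcases h2.eq_or_lt with rfl | h2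
  · have h3 : ((n : ℝ) + 1) = ((n + 1 : ℤ) : ℝ) := by push_cast; rfl
    rw [polygonalPath, h3, Int.fract_intCast, Int.floor_intCast]
    simp
  · have h3 : ⌊t⌋ = n := Int.floor_eq_iff.2 ⟨h1, h2⟩
    rw [polygonalPath, Int.fract, h3]
    push_cast
    module

lemma norm_polygonalPath_le {e : ℤ → H} (he : Orthonormal ℂ e) (t : ℝ) : ‖polygonalPath e t‖ ≤ 1 := by
  have h1 := Int.fract_nonneg t
  have h2 := Int.fract_lt_one t
  refine (norm_add_le _ _).trans ?_
  rw [norm_smul, norm_smul, he.1, he.1, Complex.norm_real, Complex.norm_real,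
    Real.norm_of_nonneg h1, Real.norm_of_nonneg (by linarith)]
  linarith

lemma le_norm_polygonalPath {e : ℤ → H} (he : Orthonormal ℂ e) (t : ℝ) : 1 / 2 ≤ ‖polygonalPath e t‖ := by
  have h1 := Int.fract_nonneg t
  have h2 := Int.fract_lt_one t
  have i1 : ‖inner ℂ (e ⌊t⌋) (polygonalPath e t)‖ = 1 - Int.fract t := by
    rw [polygonalPath, inner_add_right, inner_smul_right, inner_smul_right,
      orthonormal_iff_ite.1 he, orthonormal_iff_ite.1 he, if_pos rfl, if_neg (by simp), mul_one,
      mul_zero, add_zero, Complex.norm_real, Real.norm_of_nonneg (by linarith)]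
  have i2 : ‖inner ℂ (e (⌊t⌋ + 1)) (polygonalPath e t)‖ = Int.fract t := by
    rw [polygonalPath, inner_add_right, inner_smul_right, inner_smul_right,
      orthonormal_iff_ite.1 he, orthonormal_iff_ite.1 he, if_pos rfl, if_neg (by simp), mul_one,
      mul_zero, zero_add, Complex.norm_real, Real.norm_of_nonneg h1]
  have j1 := norm_inner_le_norm (𝕜 := ℂ) (e ⌊t⌋) (polygonalPath e t)
  have j2 := norm_inner_le_norm (𝕜 := ℂ) (e (⌊t⌋ + 1)) (polygonalPath e t)
  rw [he.1, one_mul] at j1 j2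
  linarith

lemma inner_polygonalPath_eq_zero {e : ℤ → H} (he : Orthonormal ℂ e) {s t : ℝ} (h : 2 ≤ |s - t|) :
    inner ℂ (polygonalPath e s) (polygonalPath e t) = 0 := by
  have hst : ⌊s⌋ + 1 < ⌊t⌋ ∨ ⌊t⌋ + 1 < ⌊s⌋ := by
    have s1 := Int.floor_le s
    have s2 := Int.lt_floor_add_one s
    have t1 := Int.floor_le t
    have t2 := Int.lt_floor_add_one t
    rcases le_abs.1 h with h | h
    · right
      have : ((⌊t⌋ + 1 : ℤ) : ℝ) < ⌊s⌋ := by push_cast; linarith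
      exact_mod_cast this
    · left
      have : ((⌊s⌋ + 1 : ℤ) : ℝ) < ⌊t⌋ := by push_cast; linarith
      exact_mod_cast this
  simp only [polygonalPath, inner_add_right, inner_add_left, inner_smul_right, inner_smul_left,
    orthonormal_iff_ite.1 he]
  rw [if_neg (by lia), if_neg (by lia), if_neg (by lia), if_neg (by lia)]
  simp

lemma uniformContinuous_polygonalPath {e : ℤ → H} (he : Orthonormal ℂ e) :
    UniformContinuous (polygonalPath e) := by
  have key : ∀ (n : ℤ) (s t : ℝ), n ≤ s → s ≤ t → t ≤ n + 1 →
      dist (polygonalPath e s) (polygonalPath e t) ≤ 2 * (t - s) := by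
    intro n s t h1 h2 h3
    rw [dist_comm, dist_eq_norm, polygonalPath_eq e h1 (h2.trans h3),
      polygonalPath_eq e (h1.trans h2) h3, add_sub_add_left_eq_sub, ← sub_smul,
      ← Complex.ofReal_sub, norm_smul, Complex.norm_real, Real.norm_of_nonneg (by linarith)]
    have h4 := norm_sub_le (e (n + 1)) (e n)
    rw [he.1, he.1] at h4
    nlinarith
  have near : ∀ s t : ℝ, s ≤ t → t - s < 1 →
      dist (polygonalPath e s) (polygonalPath e t) ≤ 2 * (t - s) := by
    intro s t hst h1
    have s1 := Int.floor_le s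
    have s2 := Int.lt_floor_add_one s
    rcases le_total t (⌊s⌋ + 1) with h | h
    · exact key ⌊s⌋ s t s1 hst h
    · have k1 := key ⌊s⌋ s (⌊s⌋ + 1) s1 s2.le le_rfl
      have k2 := key (⌊s⌋ + 1) (⌊s⌋ + 1) t (by push_cast; rfl) h (by push_cast; linarith)
      linarith [dist_triangle (polygonalPath e s) (polygonalPath e (⌊s⌋ + 1)) (polygonalPath e t)]
  refine Metric.uniformContinuous_iff.2 fun ε hε => ⟨min 1 (ε / 2), by positivity, ?_⟩
  intro s t hst
  rw [lt_min_iff, Real.dist_eq] at hst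
  rcases le_total s t with h | h
  · rw [abs_sub_comm, abs_of_nonneg (by linarith)] at hst
    linarith [near s t h hst.1]
  · rw [abs_of_nonneg (by linarith)] at hst
    rw [dist_comm]
    linarith [near t s h hst.1]

end Hilbert


/-- For every infinite-dimensional complex Hilbert space `H` there exists a bounded
uniformly continuous `f : ℝ → H` that is Eberlein almost periodic (its orbit is
relatively compact in the weak topology of `C_b(ℝ,H)`) but not pseudo almost periodic:
`f` admits no decomposition `f = g + h` with `g` almost periodic and `h ∈ PAP₀(ℝ,H)`. -/
theorem exists_EAP_not_PAP
    (H : Type*) [NormedAddCommGroup H] [InnerProductSpace ℂ H] [CompleteSpace H]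
    (hH : ¬ FiniteDimensional ℂ H) :
    ∃ f : ℝ →ᵇ H, UniformContinuous ⇑f ∧
      IsCompact (closure ((toWeakSpace ℂ (ℝ →ᵇ H)) '' Set.range (translateBCF f))) ∧
      ¬ ∃ (g h : ℝ →ᵇ H), IsAP g ∧
          Tendsto (fun T : ℝ => (1/(2*T)) * ∫ t in (-T)..T, ‖h t‖) atTop (𝓝 0) ∧
          f = g + h := by
  obtain ⟨e, he⟩ := exists_orthonormal_int hH
  have hu := uniformContinuous_polygonalPath he
  let f : ℝ →ᵇ H := .ofNormedAddCommGroup (polygonalPath e) hu.continuous 1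
    (norm_polygonalPath_le he)
  have hf := tendsto_dual_translate_zero f (norm_polygonalPath_le he)
    fun _ _ h => inner_polygonalPath_eq_zero he h
  exact ⟨f, hu, isCompact_closure_weak_orbit hu hf,
    not_pseudoAlmostPeriodic one_half_pos (le_norm_polygonalPath he) hf⟩
end

section
/- Let X be a complex Banach space and let f ∈ EAP_0(ℝ,X), i.e. f ∈ C_b(ℝ,X), the orbit {f_s : s ∈ ℝ} is relatively compact in the weak topology of C_b(ℝ,X), and 0 lies in the weak closure of the orbit. Then every Fourier coefficient of f vanishes: for each λ ∈ ℝ, (1/(2T)) ∫_{−T}^{T} e^{−iλt} f(t) dt → 0 in X as T → ∞. -/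
open BoundedContinuousFunction Filter Topology Complex

/-- The averaged Fourier functional `g ↦ (1/(2T)) ∫_{-T}^{T} e^{-iλt} g t dt` as a continuous
linear map on bounded continuous functions. -/
noncomputable def fourierMean {X : Type*} [NormedAddCommGroup X] [NormedSpace ℂ X]
    (lam T : ℝ) : (ℝ →ᵇ X) →L[ℂ] X :=
  LinearMap.mkContinuous
    { toFun := fun g => (1/(2*T)) • ∫ t in (-T)..T, Complex.exp (-(I * lam * t)) • g t
      map_add' := fun g h => by
        have hi : ∀ g : ℝ →ᵇ X, IntervalIntegrable
            (fun t : ℝ => Complex.exp (-(I * lam * t)) • g t) MeasureTheory.volume (-T) T :=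
          fun g => Continuous.intervalIntegrable
            (Continuous.smul (by fun_prop) g.continuous) _ _
        simp only [BoundedContinuousFunction.add_apply, smul_add]
        rw [intervalIntegral.integral_add (hi g) (hi h), smul_add]
      map_smul' := fun c g => by
        simp only [BoundedContinuousFunction.smul_apply, RingHom.id_apply]
        simp_rw [smul_comm _ c]
        rw [intervalIntegral.integral_smul, smul_comm] }
    1 (fun g => by
      have hb : ‖∫ t in (-T)..T, Complex.exp (-(I * lam * t)) • g t‖ ≤ ‖g‖ * |T - -T| := by
        refine intervalIntegral.norm_integral_le_of_norm_le_const fun t _ => ?_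
        rw [norm_smul, Complex.norm_exp]
        simpa using g.norm_coe_le_norm t
      simp only [LinearMap.coe_mk, AddHom.coe_mk, norm_smul, one_mul]
      rcases eq_or_ne T 0 with rfl | hT
      · simp
      · calc _ ≤ ‖1/(2*T)‖ * (‖g‖ * |T - -T|) := by gcongr
          _ = ‖g‖ := by
            have h2 : |T - -T| = |2*T| := by ring_nf
            have h3 : |2*T| ≠ 0 := by simpa using hT
            rw [h2, Real.norm_eq_abs, abs_div, abs_one]
            field_simp)

theorem fourierMean_apply {X : Type*} [NormedAddCommGroup X] [NormedSpace ℂ X]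
    (lam T : ℝ) (g : ℝ →ᵇ X) :
    fourierMean lam T g = (1/(2*T)) • ∫ t in (-T)..T, Complex.exp (-(I * lam * t)) • g t :=
  rfl

theorem norm_fourierMean_le {X : Type*} [NormedAddCommGroup X] [NormedSpace ℂ X]
    (lam T : ℝ) : ‖(fourierMean lam T : (ℝ →ᵇ X) →L[ℂ] X)‖ ≤ 1 :=
  LinearMap.mkContinuous_norm_le _ zero_le_one _

theorem norm_fourierMean_translate_sub_le {X : Type*} [NormedAddCommGroup X] [NormedSpace ℂ X]
    (lam s : ℝ) (f : ℝ →ᵇ X) {T : ℝ} (hT : 0 < T) :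
    ‖fourierMean lam T (translateBCF f s) - Complex.exp (I * lam * s) • fourierMean lam T f‖
      ≤ ‖f‖ * |s| / T := by
  set F : ℝ → X := fun t => Complex.exp (-(I * lam * t)) • f t with hF
  have hcont : Continuous F := Continuous.smul (by fun_prop) f.continuous
  have hint : ∀ a b, IntervalIntegrable F MeasureTheory.volume a b :=
    fun a b => hcont.intervalIntegrable a b
  have hbound : ∀ a b, ‖∫ t in a..b, F t‖ ≤ ‖f‖ * |b - a| := fun a b => by
    refine intervalIntegral.norm_integral_le_of_norm_le_const fun t _ => ?_
    rw [hF, norm_smul, Complex.norm_exp]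
    simpa using f.norm_coe_le_norm t
  have hshift : ∫ t in (-T)..T, Complex.exp (-(I * lam * t)) • translateBCF f s t
      = Complex.exp (I * lam * s) • ∫ t in (s + -T)..(s + T), F t := by
    rw [← intervalIntegral.integral_comp_add_left, ← intervalIntegral.integral_smul]
    refine intervalIntegral.integral_congr fun t _ => ?_
    simp only [hF, smul_smul, ← Complex.exp_add]
    have hexp : -(I * lam * t) = I * lam * s + -(I * lam * (s + t : ℝ)) := by
      push_cast
      ring
    rw [hexp]
    rfl
  have hsub : (∫ t in (s + -T)..(s + T), F t) - ∫ t in (-T)..T, F t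
      = (∫ t in T..(s + T), F t) - ∫ t in (-T)..(s + -T), F t := by
    rw [intervalIntegral.integral_interval_sub_interval_comm' (hint _ _) (hint _ _) (hint _ _)]
  have hnorm : ‖Complex.exp (I * lam * s)‖ = 1 := by
    rw [Complex.norm_exp]; simp
  rw [fourierMean_apply, fourierMean_apply, hshift, smul_comm (Complex.exp _) (1/(2*T)),
    ← smul_sub, ← smul_sub, norm_smul, norm_smul, hnorm, one_mul, hsub]
  calc _ ≤ ‖1/(2*T)‖ * (‖f‖ * |s| + ‖f‖ * |s|) := by
        gcongr
        refine (norm_sub_le _ _).trans (add_le_add ?_ ?_)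
        · simpa using hbound T (s + T)
        · simpa using hbound (-T) (s + -T)
    _ = ‖f‖ * |s| / T := by
        rw [Real.norm_of_nonneg (by positivity)]
        field_simp
        ring

/-- A continuous linear functional whose modulus is constant on the orbit of `f` vanishes at `f`
as soon as `0` is in the weak closure of the orbit. -/
theorem apply_eq_zero_of_norm_apply_translate_eq {X : Type*} [NormedAddCommGroup X]
    [NormedSpace ℂ X] {f : ℝ →ᵇ X}
    (h0 : (0 : WeakSpace ℂ (ℝ →ᵇ X)) ∈
      closure ((toWeakSpace ℂ (ℝ →ᵇ X)) '' Set.range (translateBCF f)))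
    (φ : StrongDual ℂ (ℝ →ᵇ X)) (hφ : ∀ s, ‖φ (translateBCF f s)‖ = ‖φ f‖) : φ f = 0 := by
  have hc : Continuous fun g : WeakSpace ℂ (ℝ →ᵇ X) =>
      ‖φ ((toWeakSpace ℂ (ℝ →ᵇ X)).symm g)‖ :=
    (WeakBilin.eval_continuous (topDualPairing ℂ (ℝ →ᵇ X)).flip φ).norm
  have hsub : closure ((toWeakSpace ℂ (ℝ →ᵇ X)) '' Set.range (translateBCF f)) ⊆
      {g | ‖φ ((toWeakSpace ℂ (ℝ →ᵇ X)).symm g)‖ = ‖φ f‖} := by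
    refine closure_minimal ?_ (isClosed_eq hc continuous_const)
    rintro _ ⟨_, ⟨s, rfl⟩, rfl⟩
    simpa using hφ s
  have h := hsub h0
  simp only [Set.mem_ofPred_eq, map_zero, norm_zero] at h
  exact norm_eq_zero.mp h.symm

/-- If `X` is a complex Banach space and `f ∈ EAP₀(ℝ,X)` (the orbit of `f` is relatively
compact in the weak topology of `C_b(ℝ,X)` and `0` lies in the weak closure of the orbit)
then all Fourier coefficients of `f` vanish:
`(1/(2T)) ∫_{-T}^{T} e^{-iλt} f t dt → 0` for every `λ ∈ ℝ`. -/
theorem fourier_coefficients_vanish_of_EAP0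
    {X : Type*} [NormedAddCommGroup X] [NormedSpace ℂ X] [CompleteSpace X]
    (f : ℝ →ᵇ X)
    (h1 : IsCompact (closure ((toWeakSpace ℂ (ℝ →ᵇ X)) '' Set.range (translateBCF f))))
    (h2 : (0 : WeakSpace ℂ (ℝ →ᵇ X)) ∈
      closure ((toWeakSpace ℂ (ℝ →ᵇ X)) '' Set.range (translateBCF f))) :
    ∀ lam : ℝ,
      Tendsto (fun T : ℝ => (1/(2*T)) • ∫ t in (-T)..T, Complex.exp (-(I * lam * t)) • f t)
        atTop (𝓝 (0 : X)) := by
  intro lam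
  change Tendsto (fun T : ℝ => fourierMean lam T f) atTop (𝓝 0)
  have hdual : ∀ T : ℝ, ∃ x' : StrongDual ℂ X, ‖x'‖ ≤ 1 ∧
      x' (fourierMean lam T f) = ‖fourierMean lam T f‖ :=
    fun T => exists_dual_vector'' ℂ _
  choose x' hx'_norm hx' using hdual
  rw [tendsto_iff_ultrafilter]
  intro U hU
  let Φ : ℝ → WeakDual ℂ (ℝ →ᵇ X) :=
    fun T => StrongDual.toWeakDual ((x' T).comp (fourierMean lam T))
  have hΦ_mem : ∀ T, Φ T ∈ WeakDual.toStrongDual ⁻¹'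
      Metric.closedBall (0 : StrongDual ℂ (ℝ →ᵇ X)) 1 := fun T => by
    rw [Set.mem_preimage, mem_closedBall_zero_iff]
    exact (ContinuousLinearMap.opNorm_comp_le _ _).trans
      (mul_le_one₀ (hx'_norm T) (norm_nonneg _) (norm_fourierMean_le lam T))
  obtain ⟨φ, -, hφ⟩ := (WeakDual.isCompact_closedBall (𝕜 := ℂ) (0 : StrongDual ℂ (ℝ →ᵇ X))
    1).ultrafilter_le_nhds (U.map Φ) (by
      rw [le_principal_iff]
      exact Filter.mem_map.2 (Eventually.of_forall hΦ_mem))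
  have hlim : ∀ g : ℝ →ᵇ X,
      Tendsto (fun T => x' T (fourierMean lam T g)) U (𝓝 (φ g)) := fun g =>
    ((WeakDual.eval_continuous g).tendsto φ).comp hφ
  have htranslate : ∀ s, φ (translateBCF f s) = Complex.exp (I * lam * s) * φ f := fun s => by
    have hdiff : Tendsto (fun T => x' T (fourierMean lam T (translateBCF f s))
        - Complex.exp (I * lam * s) * x' T (fourierMean lam T f)) U (𝓝 0) := by
      refine Tendsto.mono_left ?_ hU
      refine squeeze_zero_norm' ?_ (tendsto_const_nhds.div_atTop tendsto_id :
        Tendsto (fun T : ℝ => ‖f‖ * |s| / T) atTop (𝓝 0))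
      filter_upwards [eventually_gt_atTop 0] with T hT
      rw [← smul_eq_mul, ← map_smul, ← map_sub]
      refine ((x' T).le_of_opNorm_le (hx'_norm T) _).trans ?_
      rw [one_mul]
      exact norm_fourierMean_translate_sub_le lam s f hT
    exact sub_eq_zero.mp
      (tendsto_nhds_unique ((hlim _).sub ((hlim f).const_mul _)) hdiff)
  have hzero : φ f = 0 :=
    apply_eq_zero_of_norm_apply_translate_eq h2 (WeakDual.toStrongDual φ) fun s => by
      change ‖φ (translateBCF f s)‖ = ‖φ f‖
      rw [htranslate, norm_mul, Complex.norm_exp]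
      simp
  have h := (hlim f).norm
  rw [hzero, norm_zero] at h
  rw [tendsto_zero_iff_norm_tendsto_zero]
  simpa [hx'] using h
end

section
/- Let f : ℝ → ℓ¹(ℕ,ℝ) be a bounded continuous function whose orbit {f_s : s ∈ ℝ} (where f_s(t) = f(s+t)) is relatively compact in the weak topology of C_b(ℝ, ℓ¹(ℕ,ℝ)). Then the range f(ℝ) is relatively compact in the norm topology of ℓ¹(ℕ,ℝ). -/
open BoundedContinuousFunction Filter Topology

noncomputable instance : Fact ((1 : ENNReal) ≤ 1) := ⟨le_rfl⟩

namespace EllOne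

/-- The real sign `1` or `-1` encoded by a Boolean. -/
def boolSign (b : Bool) : ℝ := if b then 1 else -1

lemma abs_boolSign (b : Bool) : |boolSign b| = 1 := by
  cases b <;> simp [boolSign]

lemma boolSign_decide_mul (x : ℝ) : boolSign (decide (0 ≤ x)) * x = |x| := by
  by_cases h : 0 ≤ x
  · simp [boolSign, h, abs_of_nonneg]
  · simp [boolSign, h, abs_of_neg (not_le.mp h)]

lemma norm_boolSign_mul (b : Bool) (x : ℝ) : ‖boolSign b * x‖ = |x| := by
  rw [Real.norm_eq_abs, abs_mul, abs_boolSign, one_mul]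

lemma summable_abs (y : lp (fun _ : ℕ => ℝ) 1) : Summable fun i => |y i| := by
  simpa using (lp.memℓp y).summable (by simp)

lemma norm_eq_tsum_abs (y : lp (fun _ : ℕ => ℝ) 1) : ‖y‖ = ∑' i, |y i| := by
  rw [lp.norm_eq_tsum_rpow (by simp)]
  simp

lemma summable_boolSign_mul (σ : ℕ → Bool) (y : lp (fun _ : ℕ => ℝ) 1) :
    Summable fun i => boolSign (σ i) * y i :=
  .of_norm (by simpa only [norm_boolSign_mul] using summable_abs y)

/-- The functional on `ℓ¹` given by pairing with a sequence of signs. -/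
noncomputable def signFunctional (σ : ℕ → Bool) : lp (fun _ : ℕ => ℝ) 1 →L[ℝ] ℝ :=
  LinearMap.mkContinuous
    { toFun := fun y => ∑' i, boolSign (σ i) * y i
      map_add' := fun x y => by
        rw [← (summable_boolSign_mul σ x).tsum_add (summable_boolSign_mul σ y)]
        simp [mul_add]
      map_smul' := fun c y => by
        simp only [RingHom.id_apply, smul_eq_mul, ← tsum_mul_left]
        refine tsum_congr fun i => ?_
        simp [mul_left_comm] }
    1 fun y => by
      rw [one_mul, norm_eq_tsum_abs]
      refine (norm_tsum_le_tsum_norm ?_).trans_eq ?_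
      · simpa only [norm_boolSign_mul] using summable_abs y
      · simp only [norm_boolSign_mul]

lemma signFunctional_apply (σ : ℕ → Bool) (y : lp (fun _ : ℕ => ℝ) 1) :
    signFunctional σ y = ∑' i, boolSign (σ i) * y i := rfl

lemma continuous_signFunctional_apply (y : lp (fun _ : ℕ => ℝ) 1) :
    Continuous fun σ => signFunctional σ y := by
  simp only [signFunctional_apply]
  refine continuous_tsum (fun i => ?_) (summable_abs y) fun i σ => (norm_boolSign_mul _ _).le
  exact ((continuous_of_discreteTopology (f := boolSign)).comp (continuous_apply i)).mul_const _

lemma norm_le_signFunctional_add (I : Finset ℕ) (σ : ℕ → Bool) (y : lp (fun _ : ℕ => ℝ) 1) :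
    ‖y‖ ≤ signFunctional (fun i => if i ∈ I then σ i else decide (0 ≤ y i)) y
      + 2 * ∑ i ∈ I, |y i| := by
  have hI : ∑' i, (if i ∈ I then |y i| else 0) = ∑ i ∈ I, |y i| := by
    rw [tsum_eq_sum (s := I) fun i hi => if_neg hi]
    exact Finset.sum_congr rfl fun i hi => if_pos hi
  have hs : Summable fun i => if i ∈ I then |y i| else 0 :=
    summable_of_ne_finset_zero (s := I) fun i hi => if_neg hi
  rw [norm_eq_tsum_abs, signFunctional_apply, ← hI, ← tsum_mul_left,
    ← (summable_boolSign_mul _ y).tsum_add (hs.mul_left 2)]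
  refine (summable_abs y).tsum_le_tsum (fun i => ?_)
    ((summable_boolSign_mul _ y).add (hs.mul_left 2))
  by_cases hi : i ∈ I
  · have h := neg_abs_le (boolSign (σ i) * y i)
    rw [abs_mul, abs_boolSign, one_mul] at h
    simp only [hi, if_true]
    linarith
  · simp [hi, boolSign_decide_mul]

/-- **Schur's theorem**: weakly null sequences in `ℓ¹` are norm null. -/
theorem tendsto_zero_of_weakly_null (y : ℕ → lp (fun _ : ℕ => ℝ) 1)
    (h : ∀ φ : lp (fun _ : ℕ => ℝ) 1 →L[ℝ] ℝ, Tendsto (fun n => φ (y n)) atTop (𝓝 0)) :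
    Tendsto y atTop (𝓝 0) := by
  rw [tendsto_zero_iff_norm_tendsto_zero, Metric.tendsto_atTop']
  intro ε hε
  let F : ℕ → Set (ℕ → Bool) := fun N => ⋂ n ≥ N, {σ | |signFunctional σ (y n)| ≤ ε / 4}
  have hF : ∀ N, IsClosed (F N) := fun N =>
    isClosed_biInter fun n _ =>
      isClosed_le (continuous_signFunctional_apply (y n)).abs continuous_const
  have hU : ⋃ N, F N = Set.univ := by
    refine Set.eq_univ_of_forall fun σ => ?_
    obtain ⟨N, hN⟩ := Metric.tendsto_atTop.1 (h (signFunctional σ)) (ε / 4) (by positivity)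
    refine Set.mem_iUnion.2 ⟨N, Set.mem_iInter₂.2 fun n hn => ?_⟩
    simpa using (hN n hn).le
  obtain ⟨N, σ, hσ⟩ := nonempty_interior_of_iUnion_of_closed hF hU
  obtain ⟨I, u, hu, hsub⟩ := isOpen_pi_iff.1 isOpen_interior σ hσ
  have hI : Tendsto (fun n => ∑ i ∈ I, |y n i|) atTop (𝓝 0) := by
    have := tendsto_finsetSum I fun i _ => (h (lp.evalCLM ℝ (fun _ : ℕ => ℝ) 1 i)).abs
    simp only [abs_zero, Finset.sum_const_zero] at this
    exact this
  obtain ⟨M, hM⟩ := Metric.tendsto_atTop.1 hI (ε / 4) (by positivity)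
  refine ⟨max N M, fun n hn => ?_⟩
  have hmem : (fun i => if i ∈ I then σ i else decide (0 ≤ y n i)) ∈ F N := by
    refine interior_subset (hsub fun i hi => ?_)
    rw [Finset.mem_coe] at hi
    simpa only [hi, if_true] using (hu i hi).2
  have h₁ : |_| ≤ ε / 4 := Set.mem_iInter₂.1 hmem n (by omega)
  have h₂ := hM n (by omega)
  rw [Real.dist_0_eq_abs] at h₂
  have h₃ := norm_le_signFunctional_add I σ (y n)
  rw [Real.dist_0_eq_abs, abs_norm]
  linarith [le_of_abs_le h₁, lt_of_abs_lt h₂]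

/-- Weakly compact subsets of `ℓ¹` are norm compact. -/
theorem isCompact_of_isCompact_weak {K : Set (WeakSpace ℝ (lp (fun _ : ℕ => ℝ) 1))}
    (hK : IsCompact K) : IsCompact (toWeakSpace ℝ (lp (fun _ : ℕ => ℝ) 1) ⁻¹' K) := by
  have hφ : ∀ φ : lp (fun _ : ℕ => ℝ) 1 →L[ℝ] ℝ, Continuous fun x : WeakSpace ℝ _ =>
      φ ((toWeakSpace ℝ _).symm x) := fun φ => WeakBilin.eval_continuous _ φ
  let c : WeakSpace ℝ (lp (fun _ : ℕ => ℝ) 1) → ℕ → ℝ := fun x i =>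
    (toWeakSpace ℝ _).symm x i
  have hc : Continuous c :=
    continuous_pi fun i => hφ (lp.evalCLM ℝ (fun _ : ℕ => ℝ) 1 i)
  have hinj : Function.Injective c := fun x x' hxx' =>
    (toWeakSpace ℝ _).symm.injective (lp.ext hxx')
  rw [isCompact_iff_isSeqCompact]
  intro x hx
  obtain ⟨-, ⟨a, ha, rfl⟩, θ, hθ, hlim⟩ := (hK.image hc).isSeqCompact
    fun n => Set.mem_image_of_mem c (hx n)
  have hweak : Tendsto (fun n => toWeakSpace ℝ _ (x (θ n))) atTop (𝓝 a) := by
    refine hK.tendsto_nhds_of_unique_mapClusterPt (.of_forall fun n => hx _) fun b _ hb => ?_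
    have : NeBot (𝓝 (c b) ⊓ 𝓝 (c a)) := ClusterPt.mono (hb.tendsto_comp (hc.tendsto b)) hlim
    exact hinj (eq_of_nhds_neBot this)
  refine ⟨(toWeakSpace ℝ _).symm a, by simpa using ha, θ, hθ, ?_⟩
  rw [← tendsto_sub_nhds_zero_iff]
  refine tendsto_zero_of_weakly_null _ fun φ => ?_
  have := ((hφ φ).tendsto a).comp hweak
  rw [← tendsto_sub_nhds_zero_iff] at this
  simpa [Function.comp_def] using this

end EllOne

/-- If `f : ℝ → ℓ¹(ℕ,ℝ)` is bounded continuous with orbit relatively compact in the weak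
topology of `C_b(ℝ,ℓ¹)`, then the range of `f` is relatively compact in the norm
topology of `ℓ¹(ℕ,ℝ)`. -/
theorem range_relCompact_of_EAP_l1
    (f : ℝ →ᵇ (lp (fun _ : ℕ => ℝ) 1))
    (hf : IsCompact (closure ((toWeakSpace ℝ (ℝ →ᵇ (lp (fun _ : ℕ => ℝ) 1))) ''
      Set.range (translateBCF f)))) :
    IsCompact (closure (Set.range ⇑f)) := by
  let E := WeakSpace.map (BoundedContinuousFunction.evalCLM ℝ (β := lp (fun _ : ℕ => ℝ) 1) (0 : ℝ))
  refine (EllOne.isCompact_of_isCompact_weak (hf.image E.continuous)).closure_of_subset ?_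
  rintro _ ⟨s, rfl⟩
  refine ⟨toWeakSpace ℝ _ (translateBCF f s),
    subset_closure (Set.mem_image_of_mem _ (Set.mem_range_self s)), ?_⟩
  change f (s + 0) = f s
  rw [add_zero]
end

section
/- Let H be a complex Hilbert space and f ∈ C_b(ℝ,H) an Eberlein almost periodic function (the orbit {f_s : s ∈ ℝ} is relatively compact in the weak topology of C_b(ℝ,H)) whose range f(ℝ) is relatively compact in the norm topology of H. Then f is pseudo almost periodic: there exist g ∈ AP(ℝ,H) and h ∈ C_b(ℝ,H) with lim_{T→∞} (1/(2T)) ∫_{−T}^{T} ‖h(t)‖ dt = 0 such that f = g + h. -/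
open BoundedContinuousFunction Filter Topology

theorem IsCompact.image_sub {G : Type*} [AddGroup G] [TopologicalSpace G] [IsTopologicalAddGroup G]
    {s t : Set G} (hs : IsCompact s) (ht : IsCompact t) :
    IsCompact ((fun p : G × G => p.1 - p.2) '' s ×ˢ t) :=
  (hs.prod ht).image continuous_sub

/-- A compact invariant set of an action of `ℝ` by continuous maps contains a minimal set. -/
theorem exists_minimal_invariant {X : Type*} [TopologicalSpace X] [T2Space X] (T : ℝ → X → X)
    (hT : ∀ s, Continuous (T s)) (hadd : ∀ s t x, T s (T t x) = T (t + s) x)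
    {K : Set X} (hK : IsCompact K) (hne : K.Nonempty) (hinv : ∀ s, Set.MapsTo (T s) K K) :
    ∃ Y ⊆ K, IsCompact Y ∧ Y.Nonempty ∧ (∀ s, Set.MapsTo (T s) Y Y) ∧
      ∀ y ∈ Y, Y ⊆ closure (Set.range fun s => T s y) := by
  obtain ⟨Y, hYK, hY⟩ := zorn_superset_nonempty
    {Y : Set X | Y ⊆ K ∧ IsClosed Y ∧ Y.Nonempty ∧ ∀ s, Set.MapsTo (T s) Y Y} (by
      intro c hc hchain hcne
      refine ⟨⋂₀ c, ⟨?_, ?_, ?_, ?_⟩, fun s hs => Set.sInter_subset_of_mem hs⟩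
      · obtain ⟨Z, hZ⟩ := hcne
        exact (Set.sInter_subset_of_mem hZ).trans (hc hZ).1
      · exact isClosed_sInter fun Z hZ => (hc hZ).2.1
      · have : Nonempty c := hcne.to_subtype
        rw [Set.sInter_eq_iInter]
        exact IsCompact.nonempty_iInter_of_directed_nonempty_isCompact_isClosed _
          (fun A B => (hchain.total A.2 B.2).elim (fun h => ⟨A, subset_rfl, h⟩)
            fun h => ⟨B, h, subset_rfl⟩) (fun Z => (hc Z.2).2.2.1)
          (fun Z => hK.of_isClosed_subset (hc Z.2).2.1 (hc Z.2).1) (fun Z => (hc Z.2).2.1)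
      · intro s x hx Z hZ
        exact (hc hZ).2.2.2 s (hx Z hZ)) K ⟨subset_rfl, hK.isClosed, hne, hinv⟩
  obtain ⟨-, hYc, hYne, hYinv⟩ := hY.prop
  refine ⟨Y, hYK, hK.of_isClosed_subset hYc hYK, hYne, hYinv, fun y hy => ?_⟩
  have hsub : closure (Set.range fun s => T s y) ⊆ Y :=
    closure_minimal (Set.range_subset_iff.2 fun s => hYinv s hy) hYc
  refine hY.le_of_le ⟨hsub.trans hYK, isClosed_closure,
    (Set.range_nonempty _).closure, fun s => ?_⟩ hsub
  refine Set.MapsTo.closure ?_ (hT s)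
  rintro _ ⟨t, rfl⟩
  exact ⟨t + s, (hadd s t y).symm⟩

section Weak

variable {E : Type*} [NormedAddCommGroup E] [NormedSpace ℂ E]

theorem continuous_apply_toWeakSpace_symm (L : E →L[ℂ] ℂ) :
    Continuous fun x : WeakSpace ℂ E => L ((toWeakSpace ℂ E).symm x) :=
  WeakBilin.eval_continuous (topDualPairing ℂ E).flip L

theorem tendsto_apply_of_tendsto_toWeakSpace {ι : Type*} {l : Filter ι} {F : ι → E} {u : E}
    (h : Tendsto (fun i => toWeakSpace ℂ E (F i)) l (𝓝 (toWeakSpace ℂ E u))) (L : E →L[ℂ] ℂ) :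
    Tendsto (fun i => L (F i)) l (𝓝 (L u)) :=
  ((continuous_apply_toWeakSpace_symm L).tendsto _).comp h

theorem exists_weak_limit {ι : Type*} (V : Ultrafilter ι) {K : Set (WeakSpace ℂ E)}
    (hK : IsCompact K) {F : ι → E} (hF : ∀ i, toWeakSpace ℂ E (F i) ∈ K) :
    ∃ u, toWeakSpace ℂ E u ∈ K ∧
      Tendsto (fun i => toWeakSpace ℂ E (F i)) V (𝓝 (toWeakSpace ℂ E u)) := by
  obtain ⟨x, hx, hl⟩ := hK.ultrafilter_le_nhds' (V.map fun i => toWeakSpace ℂ E (F i))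
    (Ultrafilter.mem_map.2 (Filter.univ_mem' hF))
  exact ⟨(toWeakSpace ℂ E).symm x, by simpa using hx, by simpa [Tendsto] using! hl⟩

theorem Convex.isClosed_toWeakSpace_image {s : Set E} (hs : Convex ℝ s) (hc : IsClosed s) :
    IsClosed (toWeakSpace ℂ E '' s) := by
  rw [← closure_eq_iff_isClosed, ← hs.toWeakSpace_closure ℂ, hc.closure_eq]

/-- **Banach-Alaoglu**: a bounded family of functionals converges weak-* along an ultrafilter. -/
theorem exists_limit_functional {ι : Type*} (V : Ultrafilter ι) (L : ι → E →L[ℂ] ℂ) (C : ℝ)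
    (hL : ∀ i, ‖L i‖ ≤ C) :
    ∃ M : E →L[ℂ] ℂ, ∀ u, Tendsto (fun i => L i u) V (𝓝 (M u)) := by
  obtain ⟨M, -, hM⟩ := (WeakDual.isCompact_closedBall (𝕜 := ℂ) (0 : StrongDual ℂ E)
    C).ultrafilter_le_nhds' (V.map fun i => StrongDual.toWeakDual (L i))
    (Ultrafilter.mem_map.2 (Filter.univ_mem' fun i => by simpa using hL i))
  exact ⟨WeakDual.toStrongDual M, fun u => ((WeakDual.eval_continuous u).tendsto M).comp hM⟩

/-- An orbit in a weakly compact, norm separable minimal set of an isometric action of `ℝ` is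
norm totally bounded. -/
theorem exists_relCompact_orbit [CompleteSpace E] (T : ℝ → E →L[ℂ] E)
    (hiso : ∀ s, Isometry (T s)) (h0 : T 0 = .id ℂ E) (hadd : ∀ s t x, T s (T t x) = T (t + s) x)
    {K : Set (WeakSpace ℂ E)} (hK : IsCompact K) (hne : K.Nonempty)
    (hinv : ∀ s x, toWeakSpace ℂ E x ∈ K → toWeakSpace ℂ E (T s x) ∈ K)
    {D : Set E} (hD : TopologicalSpace.IsSeparable D) (hKD : K ⊆ toWeakSpace ℂ E '' D) :
    ∃ y, toWeakSpace ℂ E y ∈ K ∧ IsCompact (closure (Set.range fun s => T s y)) := by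
  obtain ⟨Y, hYK, hYc, ⟨y, hy⟩, hYinv, hYmin⟩ := exists_minimal_invariant
    (fun s => WeakSpace.map (T s)) (fun s => (WeakSpace.map (T s)).continuous) (fun s t x => hadd s t x)
    hK hne (fun s x hx => hinv s x hx)
  refine ⟨(toWeakSpace ℂ E).symm y, by simpa using hYK hy, ?_⟩
  suffices h : TotallyBounded ((toWeakSpace ℂ E) ⁻¹' Y) by
    refine (h.subset ?_).closure.isCompact_of_isClosed isClosed_closure
    rintro _ ⟨s, rfl⟩
    exact hYinv s hy
  rw [Metric.totallyBounded_iff]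
  intro ε hε
  obtain ⟨c, hc, hDc⟩ := hD
  have hcne : c.Nonempty := by
    obtain ⟨x, hx, -⟩ := hKD hne.some_mem
    exact closure_nonempty_iff.1 ⟨x, hDc hx⟩
  obtain ⟨x, rfl⟩ := hc.exists_eq_range hcne
  have : CompactSpace Y := isCompact_iff_compactSpace.1 hYc
  have : Nonempty Y := ⟨⟨y, hy⟩⟩
  obtain ⟨n, z, hz⟩ := nonempty_interior_of_iUnion_of_closed
    (f := fun n : ℕ => {z : Y | z.1 ∈ toWeakSpace ℂ E '' Metric.closedBall (x n) (ε / 2)})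
    (fun n => ((convex_closedBall _ _).isClosed_toWeakSpace_image
      Metric.isClosed_closedBall).preimage continuous_subtype_val) (by
      refine Set.eq_univ_of_forall fun z => ?_
      obtain ⟨v, hv, hvz⟩ := hKD (hYK z.2)
      obtain ⟨_, ⟨n, rfl⟩, hn⟩ := Metric.mem_closure_iff.1 (hDc hv) (ε / 2) (by positivity)
      exact Set.mem_iUnion.2 ⟨n, v, hn.le, hvz⟩)
  obtain ⟨O, hO, hOz, hzO⟩ := mem_interior.1 hz
  obtain ⟨O, hOo, rfl⟩ := isOpen_induced_iff.1 hOz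
  obtain ⟨t, ht⟩ := hYc.elim_finite_subcover (fun s => WeakSpace.map (T s) ⁻¹' O)
    (fun s => hOo.preimage (WeakSpace.map (T s)).continuous) (fun v hv => by
      obtain ⟨_, hs, s, rfl⟩ := mem_closure_iff.1 (hYmin v hv z.2) O hOo hzO
      exact Set.mem_iUnion.2 ⟨s, hs⟩)
  refine ⟨(fun s => T (-s) (x n)) '' t, t.finite_toSet.image _, fun v hv => ?_⟩
  obtain ⟨s, hs, hsv⟩ := Set.mem_iUnion₂.1 (ht hv)
  obtain ⟨v', hv', hvv'⟩ := hO (show (⟨_, hYinv s hv⟩ : Y) ∈ _ from hsv)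
  have hvv : T s v = v' := hvv'.symm
  refine Set.mem_iUnion₂.2 ⟨_, ⟨s, hs, rfl⟩, ?_⟩
  rw [Metric.mem_ball, ← (hiso s).dist_eq, hadd, neg_add_cancel, h0, hvv]
  exact (Metric.mem_closedBall.1 hv').trans_lt (by simpa using! half_lt_self hε)

end Weak

section Mean

open MeasureTheory

theorem tendsto_average_translate_sub {ψ : ℝ → ℝ} (hψ : Continuous ψ) {M : ℝ}
    (hM : ∀ t, ‖ψ t‖ ≤ M) (s : ℝ) :
    Tendsto (fun T : ℝ => (1 / (2 * T)) * (∫ t in (-T)..T, ψ (s + t)) -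
      (1 / (2 * T)) * ∫ t in (-T)..T, ψ t) atTop (𝓝 0) := by
  have hlim : Tendsto (fun T : ℝ => (1 / (2 * T)) * (M * |s| + M * |s|)) atTop (𝓝 0) := by
    have h2 : Tendsto (fun T : ℝ => 2 * T) atTop atTop :=
      tendsto_id.const_mul_atTop (by norm_num)
    simpa using (h2.const_div_atTop 1).mul_const (M * |s| + M * |s|)
  refine squeeze_zero_norm' ?_ hlim
  filter_upwards [eventually_gt_atTop 0] with T hT
  rw [← mul_sub, norm_mul, Real.norm_of_nonneg (by positivity : 0 ≤ 1 / (2 * T))]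
  gcongr
  rw [intervalIntegral.integral_comp_add_left (fun t => ψ t) s,
    intervalIntegral.integral_interval_sub_interval_comm (hψ.intervalIntegrable _ _)
      (hψ.intervalIntegrable _ _) (hψ.intervalIntegrable _ _)]
  refine (norm_sub_le _ _).trans (add_le_add ?_ ?_)
  · refine (intervalIntegral.norm_integral_le_of_norm_le_const fun t _ => hM t).trans_eq ?_
    rw [show -T - (s + -T) = -s by ring, abs_neg]
  · refine (intervalIntegral.norm_integral_le_of_norm_le_const fun t _ => hM t).trans_eq ?_
    rw [show T - (s + T) = -s by ring, abs_neg]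

/-- The means over `[-T, T]` have a limit along any ultrafilter, represented by a probability
measure on the Stone-Čech compactification. -/
theorem exists_mean_measure [MeasurableSpace (StoneCech ℝ)] [BorelSpace (StoneCech ℝ)]
    (U : Ultrafilter ℝ) (hU : (U : Filter ℝ) ≤ atTop) :
    ∃ μ : ProbabilityMeasure (StoneCech ℝ), ∀ φ : StoneCech ℝ →ᵇ ℝ,
      Tendsto (fun T : ℝ => (1 / (2 * T)) * ∫ t in (-T)..T, φ (stoneCechUnit t)) U
        (𝓝 (∫ x, φ x ∂(μ : Measure (StoneCech ℝ)))) := by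
  have key : ∀ T : ℝ, ∃ ν : ProbabilityMeasure (StoneCech ℝ), 0 < T →
      ∀ φ : StoneCech ℝ →ᵇ ℝ, ∫ x, φ x ∂(ν : Measure (StoneCech ℝ)) =
        (1 / (2 * T)) * ∫ t in (-T)..T, φ (stoneCechUnit t) := by
    intro T
    by_cases hT : 0 < T
    · have hvol : volume (Set.Ioc (-T) T) = ENNReal.ofReal (2 * T) := by
        rw [Real.volume_Ioc]; ring_nf
      have hprob : IsProbabilityMeasure (ProbabilityTheory.cond volume (Set.Ioc (-T) T)) :=
        ProbabilityTheory.cond_isProbabilityMeasure_of_finite (by simp [hvol, hT]) (by simp)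
      have hm : AEMeasurable (stoneCechUnit : ℝ → StoneCech ℝ) (ProbabilityTheory.cond volume (Set.Ioc (-T) T)) :=
        continuous_stoneCechUnit.measurable.aemeasurable
      refine ⟨⟨_, Measure.isProbabilityMeasure_map hm⟩, fun _ φ => ?_⟩
      rw [ProbabilityMeasure.coe_mk, integral_map hm φ.continuous.aestronglyMeasurable,
        ProbabilityTheory.cond, integral_smul_measure, hvol,
        intervalIntegral.integral_of_le (by linarith)]
      simp [ENNReal.toReal_ofReal, hT.le]
    · exact ⟨⟨Measure.dirac (stoneCechUnit 0), inferInstance⟩, fun h => absurd h hT⟩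
  choose ν hν using key
  obtain ⟨μ, -, hμ⟩ := isCompact_univ.ultrafilter_le_nhds' (U.map ν) univ_mem
  refine ⟨μ, fun φ => ?_⟩
  refine (ProbabilityMeasure.tendsto_iff_forall_integral_tendsto.1
    (show Tendsto ν U (𝓝 μ) from hμ) φ).congr' ?_
  filter_upwards [hU (eventually_gt_atTop 0)] with T hT
  exact hν T hT φ

/-- If suitable translates of a bounded nonnegative function tend to zero at every point of the
Stone-Čech compactification, then the function has mean zero. -/
theorem tendsto_average_zero {ψ : ℝ → ℝ} (hψ : Continuous ψ) {M : ℝ}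
    (hM : ∀ t, ψ t ∈ Set.Icc 0 M) (s : ℕ → ℝ)
    (hs : ∀ V : Ultrafilter ℝ, ∃ l : ℕ → ℝ,
      (∀ n, Tendsto (fun t => ψ (s n + t)) V (𝓝 (l n))) ∧ Tendsto l atTop (𝓝 0)) :
    Tendsto (fun T : ℝ => (1 / (2 * T)) * ∫ t in (-T)..T, ψ t) atTop (𝓝 0) := by
  let _ : MeasurableSpace (StoneCech ℝ) := borel _
  have _ : BorelSpace (StoneCech ℝ) := ⟨rfl⟩
  have hM' : ∀ t, ‖ψ t‖ ≤ M := fun t => by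
    rw [Real.norm_of_nonneg (hM t).1]; exact (hM t).2
  have ext : ∀ r : ℝ, ∃ φ : StoneCech ℝ →ᵇ ℝ, (∀ t, φ (stoneCechUnit t) = ψ (r + t)) ∧
      ∀ x, φ x ∈ Set.Icc 0 M := by
    intro r
    have hc : Continuous fun t => (⟨ψ (r + t), hM _⟩ : Set.Icc (0 : ℝ) M) := by fun_prop
    exact ⟨.mkOfCompact ⟨fun x => (stoneCechExtend hc x).1,
      continuous_subtype_val.comp (continuous_stoneCechExtend hc)⟩, fun t => by simp,
      fun x => (stoneCechExtend hc x).2⟩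
  choose φ hφ hφM using ext
  rw [tendsto_iff_ultrafilter]
  intro U hU
  obtain ⟨μ, hμ⟩ := exists_mean_measure U hU
  have h0 : Tendsto (fun T : ℝ => (1 / (2 * T)) * ∫ t in (-T)..T, ψ t) U
      (𝓝 (∫ x, φ 0 x ∂(μ : Measure (StoneCech ℝ)))) := by
    simpa only [hφ, zero_add] using hμ (φ 0)
  have heq : ∀ n, ∫ x, φ (s n) x ∂(μ : Measure (StoneCech ℝ)) =
      ∫ x, φ 0 x ∂(μ : Measure (StoneCech ℝ)) := by
    intro n
    have h := hμ (φ (s n))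
    simp only [hφ] at h
    exact sub_eq_zero.1 (tendsto_nhds_unique (h.sub h0)
      ((tendsto_average_translate_sub hψ hM' (s n)).mono_left hU))
  have hpt : ∀ x, Tendsto (fun n => φ (s n) x) atTop (𝓝 0) := by
    intro x
    obtain ⟨W, hW, hWx⟩ := mem_closure_iff_ultrafilter.1 (denseRange_stoneCechUnit x)
    obtain ⟨V, rfl⟩ : ∃ V : Ultrafilter ℝ, V.map stoneCechUnit = W :=
      ⟨W.ofComapInfPrincipal (m := stoneCechUnit) (s := Set.univ) (by simpa using hW),
        W.ofComapInfPrincipal_eq_of_map _⟩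
    obtain ⟨l, hl, hl0⟩ := hs V
    refine hl0.congr fun n => tendsto_nhds_unique (hl n) ?_
    have : Tendsto (fun t => φ (s n) (stoneCechUnit t)) V (𝓝 (φ (s n) x)) :=
      ((φ (s n)).continuous.tendsto x).comp hWx
    simpa only [hφ] using this
  have hlim : Tendsto (fun n => ∫ x, φ (s n) x ∂(μ : Measure (StoneCech ℝ))) atTop
      (𝓝 (∫ _, 0 ∂(μ : Measure (StoneCech ℝ)))) :=
    tendsto_integral_of_dominated_convergence (fun _ => M)
      (fun n => (φ (s n)).continuous.aestronglyMeasurable) (integrable_const M)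
      (fun n => .of_forall fun x => by
        rw [Real.norm_of_nonneg (hφM _ x).1]; exact (hφM _ x).2) (.of_forall hpt)
  simp only [heq, integral_zero] at hlim
  rwa [tendsto_nhds_unique tendsto_const_nhds hlim] at h0

end Mean

section Translation

variable {H : Type*} [NormedAddCommGroup H]

@[simp]
theorem translateBCF_apply (f : ℝ →ᵇ H) (s t : ℝ) : translateBCF f s t = f (s + t) := rfl

theorem translateBCF_zero (f : ℝ →ᵇ H) : translateBCF f 0 = f := by
  ext t; simp

theorem translateBCF_translateBCF (f : ℝ →ᵇ H) (s t : ℝ) :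
    translateBCF (translateBCF f t) s = translateBCF f (t + s) := by
  ext r; simp [add_assoc]

theorem translateBCF_sub (f g : ℝ →ᵇ H) (s : ℝ) :
    translateBCF (f - g) s = translateBCF f s - translateBCF g s := rfl

variable [InnerProductSpace ℂ H]

/-- Translation by `s` as a linear isometry of `C_b(ℝ,H)`. -/
noncomputable def translateLI (s : ℝ) : (ℝ →ᵇ H) →ₗᵢ[ℂ] (ℝ →ᵇ H) where
  toFun f := translateBCF f s
  map_add' _ _ := rfl
  map_smul' _ _ := rfl
  norm_map' f := by
    refine le_antisymm ((norm_le (norm_nonneg _)).2 fun t => f.norm_coe_le_norm _)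
      ((norm_le (norm_nonneg _)).2 fun t => ?_)
    simpa using! (translateBCF f s).norm_coe_le_norm (-s + t)

theorem translateLI_apply (s : ℝ) (f : ℝ →ᵇ H) : translateLI s f = translateBCF f s := rfl

/-- The functional `u ↦ ⟪e, u t⟫` on `C_b(ℝ,H)`. -/
noncomputable def evalInner (e : H) (t : ℝ) : (ℝ →ᵇ H) →L[ℂ] ℂ :=
  (innerSL ℂ e).comp (BoundedContinuousFunction.evalCLM ℂ t)

@[simp]
theorem evalInner_apply (e : H) (t : ℝ) (u : ℝ →ᵇ H) : evalInner e t u = inner ℂ e (u t) := rfl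

theorem norm_evalInner_le (e : H) (t : ℝ) : ‖evalInner e t‖ ≤ ‖e‖ :=
  ContinuousLinearMap.opNorm_le_bound _ (norm_nonneg _) fun u =>
    (norm_inner_le_norm _ _).trans (by gcongr; exact u.norm_coe_le_norm t)

/-- In a norm compact subset of a Hilbert space, weak convergence implies norm convergence. -/
theorem IsCompact.tendsto_of_tendsto_inner {ι : Type*} {l : Filter ι} {C : Set H}
    (hC : IsCompact C) {x : ι → H} {c : H} (hx : ∀ i, x i ∈ C)
    (h : ∀ e, Tendsto (fun i => inner ℂ e (x i)) l (𝓝 (inner ℂ e c))) : Tendsto x l (𝓝 c) := by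
  rw [tendsto_iff_ultrafilter]
  intro U hU
  obtain ⟨d, -, hd⟩ := hC.ultrafilter_le_nhds' (U.map x)
    (Ultrafilter.mem_map.2 (Filter.univ_mem' hx))
  have hd' : Tendsto x U (𝓝 d) := hd
  have : d = c := ext_inner_left ℂ fun e =>
    tendsto_nhds_unique (tendsto_const_nhds.inner hd') ((h e).mono_left hU)
  rwa [this] at hd'

/-- A weakly relatively compact orbit lies in a norm separable weakly closed set. -/
theorem exists_separable_of_weak_compact_orbit (f : ℝ →ᵇ H)
    (hf : IsCompact (closure ((toWeakSpace ℂ (ℝ →ᵇ H)) '' Set.range (translateBCF f)))) :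
    ∃ D : Set (ℝ →ᵇ H), TopologicalSpace.IsSeparable D ∧
      closure ((toWeakSpace ℂ (ℝ →ᵇ H)) '' Set.range (translateBCF f)) ⊆
        toWeakSpace ℂ (ℝ →ᵇ H) '' D := by
  set S : Submodule ℂ (ℝ →ᵇ H) := Submodule.span ℂ (Set.range fun q : ℚ => translateBCF f q)
  have hconv : Convex ℝ (closure (S : Set (ℝ →ᵇ H))) :=
    (S.restrictScalars ℝ).convex.closure
  have hcl := hconv.isClosed_toWeakSpace_image isClosed_closure
  refine ⟨closure S, ((Set.countable_range _).isSeparable.span (R := ℂ)).closure,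
    closure_minimal ?_ hcl⟩
  rintro _ ⟨_, ⟨s, rfl⟩, rfl⟩
  have hs : s ∈ closure (Set.range ((↑) : ℚ → ℝ)) := Rat.denseRange_cast s
  obtain ⟨V, hV, hVs⟩ := mem_closure_iff_ultrafilter.1 hs
  obtain ⟨u, -, hu⟩ := exists_weak_limit V hf (F := translateBCF f)
    fun t => subset_closure ⟨_, ⟨t, rfl⟩, rfl⟩
  have hus : u = translateBCF f s := by
    ext t
    refine ext_inner_left ℂ fun e => tendsto_nhds_unique
      (tendsto_apply_of_tendsto_toWeakSpace hu (evalInner e t)) ?_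
    have : Continuous fun r => (inner ℂ e (f (r + t)) : ℂ) := by fun_prop
    exact (this.tendsto s).mono_left hVs
  rw [← hus]
  refine hcl.mem_of_tendsto hu ?_
  filter_upwards [hV]
  rintro _ ⟨q, rfl⟩
  exact ⟨_, subset_closure (Submodule.subset_span ⟨q, rfl⟩), rfl⟩

theorem IsAP.of_mem_closure {g y : ℝ →ᵇ H} (hy : IsAP y)
    (hg : g ∈ closure (Set.range (translateBCF y))) : IsAP g := by
  refine IsCompact.of_isClosed_subset hy isClosed_closure (closure_minimal ?_ isClosed_closure)
  rintro _ ⟨s, rfl⟩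
  refine map_mem_closure (f := translateLI s) (translateLI s).continuous hg ?_
  rintro _ ⟨t, rfl⟩
  exact ⟨t + s, (translateBCF_translateBCF y s t).symm⟩

/-- An Eberlein almost periodic function differs from an almost periodic function by a function
whose translates tend weakly to zero along some ultrafilter. -/
theorem exists_isAP_sub_flight [CompleteSpace H] (f : ℝ →ᵇ H)
    (hf : IsCompact (closure ((toWeakSpace ℂ (ℝ →ᵇ H)) '' Set.range (translateBCF f)))) :
    ∃ g : ℝ →ᵇ H, IsAP g ∧ ∃ V : Ultrafilter ℝ,
      Tendsto (fun s => toWeakSpace ℂ (ℝ →ᵇ H) (translateBCF (f - g) s)) V (𝓝 0) := by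
  obtain ⟨D, hD, hKD⟩ := exists_separable_of_weak_compact_orbit f hf
  obtain ⟨y, hyK, hy⟩ := exists_relCompact_orbit
    (fun s => (translateLI (H := H) s).toContinuousLinearMap) (fun s => (translateLI s).isometry)
    (by ext1 u; exact translateBCF_zero u) (fun s t x => translateBCF_translateBCF x s t) hf
    ((Set.range_nonempty _).image _).closure
    (fun s x hx => map_mem_closure
      (f := WeakSpace.map (translateLI (H := H) s).toContinuousLinearMap)
      (ContinuousLinearMap.continuous _) hx (by
        rintro _ ⟨_, ⟨t, rfl⟩, rfl⟩
        exact ⟨_, ⟨t + s, rfl⟩, congrArg _ (translateBCF_translateBCF f s t).symm⟩)) hD hKD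
  have hyAP : IsAP y := hy
  obtain ⟨W, hW, hWy⟩ := mem_closure_iff_ultrafilter.1 hyK
  rw [← Set.range_comp] at hW
  obtain ⟨V, rfl⟩ : ∃ V : Ultrafilter ℝ, V.map (toWeakSpace ℂ (ℝ →ᵇ H) ∘ translateBCF f) = W :=
    ⟨W.ofComapInfPrincipal (m := toWeakSpace ℂ (ℝ →ᵇ H) ∘ translateBCF f) (s := Set.univ)
      (by simpa only [Set.image_univ] using hW), W.ofComapInfPrincipal_eq_of_map _⟩
  have hfy : Tendsto (fun s => toWeakSpace ℂ (ℝ →ᵇ H) (translateBCF f s)) V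
      (𝓝 (toWeakSpace ℂ (ℝ →ᵇ H) y)) := hWy
  obtain ⟨g, hg, hVg⟩ := hyAP.ultrafilter_le_nhds' (V.map fun s => translateBCF y (-s))
    (Ultrafilter.mem_map.2 (Filter.univ_mem' fun s => subset_closure ⟨-s, rfl⟩))
  have hVg : Tendsto (fun s => translateBCF y (-s)) V (𝓝 g) := hVg
  have hgy : Tendsto (fun s => translateBCF g s) V (𝓝 y) := by
    rw [tendsto_iff_dist_tendsto_zero] at hVg ⊢
    refine hVg.congr fun s => ?_
    rw [← (translateLI (H := H) s).isometry.dist_eq, translateLI_apply, translateLI_apply,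
      translateBCF_translateBCF, neg_add_cancel, translateBCF_zero, dist_comm]
  refine ⟨g, hyAP.of_mem_closure hg, V, ?_⟩
  have := hfy.sub (((toWeakSpaceCLM ℂ (ℝ →ᵇ H)).continuous.tendsto y).comp hgy)
  simpa [translateBCF_sub] using! this

/-- A function with weakly relatively compact orbit and norm relatively compact range whose
translates accumulate weakly at zero has mean norm zero. -/
theorem tendsto_average_norm_zero (h : ℝ →ᵇ H) {K : Set (WeakSpace ℂ (ℝ →ᵇ H))}
    (hK : IsCompact K) (hhK : ∀ s, toWeakSpace ℂ (ℝ →ᵇ H) (translateBCF h s) ∈ K)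
    {C : Set H} (hC : IsCompact C) (hhC : ∀ t, h t ∈ C) (V : Ultrafilter ℝ)
    (hV : Tendsto (fun s => toWeakSpace ℂ (ℝ →ᵇ H) (translateBCF h s)) V (𝓝 0)) :
    Tendsto (fun T : ℝ => (1 / (2 * T)) * ∫ t in (-T)..T, ‖h t‖) atTop (𝓝 0) := by
  have hpt : ∀ t, Tendsto (fun s => h (s + t)) V (𝓝 0) := fun t =>
    hC.tendsto_of_tendsto_inner (fun s => hhC _) fun e => by
      simpa using! tendsto_apply_of_tendsto_toWeakSpace (u := 0) (by simpa using hV) (evalInner e t)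
  obtain ⟨q, hq⟩ := TopologicalSpace.exists_dense_seq ℝ
  have hseq : ∀ n : ℕ, ∃ s, ∀ i ≤ n, ‖h (s + q i)‖ < 1 / ((n : ℝ) + 1) := fun n =>
    ((Set.finite_le_nat n).eventually_all.2 fun i _ => by
      have := (hpt (q i)).norm
      rw [norm_zero] at this
      exact this.eventually_lt_const Nat.one_div_pos_of_nat).exists
  choose s hs using hseq
  have hs0 : ∀ i, Tendsto (fun n => h (s n + q i)) atTop (𝓝 0) := fun i =>
    squeeze_zero_norm' ((eventually_ge_atTop i).mono fun n hn => (hs n i hn).le)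
      tendsto_one_div_add_atTop_nhds_zero_nat
  have hweak : ∀ L : (ℝ →ᵇ H) →L[ℂ] ℂ,
      Tendsto (fun n => L (translateBCF h (s n))) atTop (𝓝 0) := by
    intro L
    rw [tendsto_iff_ultrafilter]
    intro U hU
    obtain ⟨u, -, hu⟩ := exists_weak_limit U hK (F := fun n => translateBCF h (s n))
      fun n => hhK _
    have hu0 : u = 0 := by
      refine DFunLike.coe_injective (Continuous.ext_on hq u.continuous continuous_zero ?_)
      rintro _ ⟨i, rfl⟩
      refine ext_inner_left ℂ fun e => tendsto_nhds_unique
        (tendsto_apply_of_tendsto_toWeakSpace hu (evalInner e (q i))) ?_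
      exact tendsto_const_nhds.inner ((hs0 i).mono_left hU)
    simpa [hu0] using tendsto_apply_of_tendsto_toWeakSpace hu L
  refine tendsto_average_zero h.continuous.norm
    (fun t => ⟨norm_nonneg _, h.norm_coe_le_norm t⟩) s fun W => ?_
  have hlim : ∀ n, ∃ x ∈ C, Tendsto (fun t => h (s n + t)) W (𝓝 x) := fun n =>
    hC.ultrafilter_le_nhds' (W.map fun t => h (s n + t))
      (Ultrafilter.mem_map.2 (Filter.univ_mem' fun t => hhC _))
  choose x hxC hx using hlim
  refine ⟨fun n => ‖x n‖, fun n => (hx n).norm, ?_⟩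
  rw [← norm_zero (E := H)]
  refine (hC.tendsto_of_tendsto_inner hxC fun e => ?_).norm
  obtain ⟨L, hL⟩ := exists_limit_functional W (evalInner e) ‖e‖ (norm_evalInner_le e)
  rw [inner_zero_right]
  refine (hweak L).congr fun n => tendsto_nhds_unique (hL _) ?_
  exact tendsto_const_nhds.inner (hx n)

theorem IsAP.isCompact_closure_range {g : ℝ →ᵇ H} (hg : IsAP g) :
    IsCompact (closure (Set.range g)) := by
  refine (hg.image (BoundedContinuousFunction.evalCLM ℂ (0 : ℝ)).continuous).closure_of_subset ?_
  rintro _ ⟨t, rfl⟩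
  exact ⟨_, subset_closure ⟨t, rfl⟩, by simp⟩

end Translation

/-- An Eberlein almost periodic function `f : ℝ → H` (`H` a complex Hilbert space) with
relatively norm-compact range is pseudo almost periodic: `f = g + h` with `g` almost
periodic and `h ∈ PAP₀(ℝ,H)`. -/
theorem EAP_relCompact_range_implies_PAP
    {H : Type*} [NormedAddCommGroup H] [InnerProductSpace ℂ H] [CompleteSpace H]
    (f : ℝ →ᵇ H)
    (h1 : IsCompact (closure ((toWeakSpace ℂ (ℝ →ᵇ H)) '' Set.range (translateBCF f))))
    (h2 : IsCompact (closure (Set.range ⇑f))) :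
    ∃ (g h : ℝ →ᵇ H), IsAP g ∧
      Tendsto (fun T : ℝ => (1/(2*T)) * ∫ t in (-T)..T, ‖h t‖) atTop (𝓝 0) ∧
      f = g + h := by
  obtain ⟨g, hg, V, hV⟩ := exists_isAP_sub_flight f h1
  refine ⟨g, f - g, hg, ?_, (add_sub_cancel g f).symm⟩
  refine tendsto_average_norm_zero (f - g)
    (h1.image_sub (hg.image (toWeakSpaceCLM ℂ (ℝ →ᵇ H)).continuous)) (fun s => ?_)
    (h2.image_sub hg.isCompact_closure_range) (fun t => ?_) V hV
  · rw [translateBCF_sub, map_sub]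
    exact ⟨(_, _), ⟨subset_closure ⟨_, ⟨s, rfl⟩, rfl⟩, _, subset_closure ⟨s, rfl⟩, rfl⟩, rfl⟩
  · exact ⟨(_, _), ⟨subset_closure ⟨t, rfl⟩, subset_closure ⟨t, rfl⟩⟩, rfl⟩
end

section
/- For every separable infinite-dimensional complex Hilbert space H there exists f ∈ C_b(ℝ,H) such that: the orbit {f_s : s ∈ ℝ} is relatively compact in the weak topology of C_b(ℝ,H) and 0 lies in its weak closure (f ∈ EAP_0(ℝ,H)); the function t ↦ ‖f(t)‖ is continuous and periodic with period 1 (hence almost periodic); lim_{T→∞} (1/(2T)) ∫_{−T}^{T} ‖f(t)‖ dt exists and is strictly positive; yet f is not pseudo almost periodic, i.e. f cannot be written as g + h with g ∈ AP(ℝ,H) and h ∈ C_b(ℝ,H) satisfying lim_{T→∞} (1/(2T)) ∫_{−T}^{T} ‖h(t)‖ dt = 0. -/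
open BoundedContinuousFunction Filter Topology

open MeasureTheory
open scoped InnerProductSpace ENNReal

section Hilbert

variable {K H : Type*} [NormedAddCommGroup K] [InnerProductSpace ℂ K]
  [NormedAddCommGroup H] [InnerProductSpace ℂ H]

/-- An orthonormal family in a separable inner product space is countable. -/
theorem Orthonormal.countable_of_separable [TopologicalSpace.SeparableSpace K] {ι : Type*}
    {v : ι → K} (hv : Orthonormal ℂ v) : Countable ι := by
  refine Pairwise.countable_of_isOpen_disjoint (s := fun i => Metric.ball (v i) (1 / 2))
    (fun i j hij => ?_) (fun _ => Metric.isOpen_ball)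
    (fun _ => Metric.nonempty_ball.2 (by norm_num))
  refine Metric.ball_disjoint_ball ?_
  have h : ‖v i - v j‖ ^ 2 = 2 := by
    rw [@norm_sub_sq ℂ, hv.2 hij, hv.1 i, hv.1 j]
    norm_num
  rw [dist_eq_norm]
  nlinarith [norm_nonneg (v i - v j)]

/-- A separable Hilbert space embeds isometrically into every infinite-dimensional one. -/
theorem exists_linearIsometry_of_separable [CompleteSpace K] [CompleteSpace H]
    [TopologicalSpace.SeparableSpace K] (hH : ¬ FiniteDimensional ℂ H) :
    Nonempty (K →ₗᵢ[ℂ] H) := by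
  obtain ⟨w, b, -⟩ := exists_hilbertBasis ℂ K
  obtain ⟨u, c, -⟩ := exists_hilbertBasis ℂ H
  have hw : Countable w := b.orthonormal.countable_of_separable
  have hu : Infinite u := by
    by_contra hfin
    rw [not_infinite_iff_finite] at hfin
    have := Fintype.ofFinite u
    exact hH c.toOrthonormalBasis.toBasis.finiteDimensional_of_finite
  obtain ⟨i, hi⟩ := exists_injective_nat w
  let j : w → u := fun x => Infinite.natEmbedding u (i x)
  have hj : Function.Injective j := (Infinite.natEmbedding u).injective.comp hi
  have hv : Orthonormal ℂ (c ∘ j) := c.orthonormal.comp j hj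
  exact ⟨hv.orthogonalFamily.linearIsometry.comp b.repr.toLinearIsometry⟩

/-- The image of a bounded subset of a Hilbert space under a bounded operator is relatively
weakly compact. -/
theorem isCompact_closure_toWeakSpace_image [CompleteSpace K] {F : Type*} [NormedAddCommGroup F]
    [NormedSpace ℂ F] (T : K →L[ℂ] F) {S : Set K} {r : ℝ} (hS : ∀ x ∈ S, ‖x‖ ≤ r) :
    IsCompact (closure (toWeakSpace ℂ F '' (T '' S))) := by
  let Φ : WeakDual ℂ K → WeakSpace ℂ F := fun l =>
    toWeakSpace ℂ F (T ((InnerProductSpace.toDual ℂ K).symm (WeakDual.toStrongDual l)))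
  have hΦ : Continuous Φ := by
    refine WeakBilin.continuous_of_continuous_eval _ fun y => ?_
    have h : ∀ l : WeakDual ℂ K, (topDualPairing ℂ F).flip (Φ l) y =
        starRingEnd ℂ (l ((InnerProductSpace.toDual ℂ K).symm (y.comp T))) := by
      intro l
      have h1 : (y.comp T) ((InnerProductSpace.toDual ℂ K).symm (WeakDual.toStrongDual l)) =
          ⟪(InnerProductSpace.toDual ℂ K).symm (y.comp T),
            (InnerProductSpace.toDual ℂ K).symm (WeakDual.toStrongDual l)⟫_ℂ :=
        (InnerProductSpace.toDual_symm_apply).symm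
      have h2 := InnerProductSpace.toDual_symm_apply
        (x := (InnerProductSpace.toDual ℂ K).symm (y.comp T)) (y := WeakDual.toStrongDual l)
      rw [← inner_conj_symm, h2] at h1
      exact h1
    simp_rw [h]
    exact Complex.continuous_conj.comp (WeakDual.eval_continuous _)
  refine ((WeakDual.isCompact_closedBall (𝕜 := ℂ) (0 : StrongDual ℂ K) r).image
    hΦ).closure_of_subset ?_
  rintro _ ⟨_, ⟨x, hx, rfl⟩, rfl⟩
  refine ⟨StrongDual.toWeakDual (InnerProductSpace.toDual ℂ K x), ?_, ?_⟩
  · simpa using hS x hx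
  · simp [Φ]

/-- A bounded weakly null family pairs to zero uniformly on totally bounded sets. -/
theorem eventually_norm_inner_le_of_totallyBounded {ι : Type*} {l : Filter ι} {f : ι → H}
    (hf : ∀ t, ‖f t‖ ≤ 1) (hw : ∀ y, Tendsto (fun t => ⟪f t, y⟫_ℂ) l (𝓝 0)) {S : Set H}
    (hS : TotallyBounded S) {ε : ℝ} (hε : 0 < ε) :
    ∀ᶠ t in l, ∀ y ∈ S, ‖⟪f t, y⟫_ℂ‖ ≤ ε := by
  obtain ⟨s, hs, hsub⟩ := Metric.totallyBounded_iff.1 hS (ε / 2) (half_pos hε)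
  have h : ∀ᶠ t in l, ∀ z ∈ s, ‖⟪f t, z⟫_ℂ‖ < ε / 2 :=
    (hs.eventually_all).2 fun z _ => (hw z).norm.eventually_lt_const (by simpa using hε)
  filter_upwards [h] with t ht y hy
  obtain ⟨z, hz, hyz⟩ := Set.mem_iUnion₂.1 (hsub hy)
  rw [Metric.mem_ball, dist_eq_norm] at hyz
  have h1 : ⟪f t, y⟫_ℂ = ⟪f t, z⟫_ℂ + ⟪f t, y - z⟫_ℂ := by rw [← inner_add_right]; simp
  have h2 : ‖⟪f t, y - z⟫_ℂ‖ ≤ ‖y - z‖ :=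
    (norm_inner_le_norm _ _).trans (mul_le_of_le_one_left (norm_nonneg _) (hf t))
  rw [h1]
  linarith [norm_add_le ⟪f t, z⟫_ℂ ⟪f t, y - z⟫_ℂ, ht z hz]

end Hilbert

/-- A function with Bohr-mean zero norm cannot have norm eventually bounded below at `+∞`. -/
theorem not_tendsto_mean_norm_zero {X : Type*} [SeminormedAddCommGroup X] (h : ℝ →ᵇ X) {c : ℝ}
    (hc : 0 < c) (hh : ∀ᶠ t in atTop, c ≤ ‖h t‖) :
    ¬ Tendsto (fun T : ℝ => (1/(2*T)) * ∫ t in (-T)..T, ‖h t‖) atTop (𝓝 0) := by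
  intro hlim
  obtain ⟨A, hA⟩ := eventually_atTop.1 hh
  have hsmall := hlim.eventually_lt_const (show 0 < c / 4 by positivity)
  obtain ⟨T, hT, hT1, hTA⟩ := (hsmall.and ((eventually_ge_atTop 1).and
    (eventually_ge_atTop (2 * |A|)))).exists
  have hint : ∀ a b, IntervalIntegrable (fun t => ‖h t‖) volume a b := fun a b =>
    h.continuous.norm.intervalIntegrable a b
  have hAT : A ≤ T / 2 := by linarith [le_abs_self A]
  have h1 : ∫ _ in (T / 2)..T, c ≤ ∫ t in (T / 2)..T, ‖h t‖ :=
    intervalIntegral.integral_mono_on (by linarith) intervalIntegrable_const (hint _ _)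
      fun t ht => hA t (hAT.trans ht.1)
  have h2 : 0 ≤ ∫ t in (-T)..(T / 2), ‖h t‖ :=
    intervalIntegral.integral_nonneg (by linarith) fun _ _ => norm_nonneg _
  have h3 := intervalIntegral.integral_add_adjacent_intervals (hint (-T) (T / 2)) (hint (T / 2) T)
  rw [intervalIntegral.integral_const, smul_eq_mul] at h1
  rw [one_div, ← div_eq_inv_mul, div_lt_iff₀ (by linarith)] at hT
  nlinarith

/-- A unit-norm function that is weakly null at `+∞` is not pseudo almost periodic. -/
theorem not_PAP_of_weakly_null {H : Type*} [NormedAddCommGroup H] [InnerProductSpace ℂ H]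
    {f : ℝ →ᵇ H} (hf : ∀ t, ‖f t‖ = 1)
    (hw : ∀ y, Tendsto (fun t => ⟪f t, y⟫_ℂ) atTop (𝓝 0)) :
    ¬ ∃ (g h : ℝ →ᵇ H), IsAP g ∧
      Tendsto (fun T : ℝ => (1/(2*T)) * ∫ t in (-T)..T, ‖h t‖) atTop (𝓝 0) ∧ f = g + h := by
  rintro ⟨g, h, hg, hh, rfl⟩
  have hS : TotallyBounded (Set.range g) := by
    refine (IsCompact.image hg
      (continuous_eval_const (0 : ℝ))).totallyBounded.subset ?_
    rintro _ ⟨t, rfl⟩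
    exact ⟨translateBCF g t, subset_closure ⟨t, rfl⟩, by simp [translateBCF]⟩
  refine not_tendsto_mean_norm_zero h (half_pos one_pos) ?_ hh
  filter_upwards [eventually_norm_inner_le_of_totallyBounded (fun t => (hf t).le) hw hS
    (half_pos one_pos)] with t ht
  have h1 : ⟪(g + h) t, g t⟫_ℂ + ⟪(g + h) t, h t⟫_ℂ = 1 := by
    rw [← inner_add_right, ← BoundedContinuousFunction.add_apply, inner_self_eq_norm_sq_to_K,
      hf t]
    simp
  have h2 : ‖⟪(g + h) t, h t⟫_ℂ‖ ≤ ‖h t‖ := by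
    simpa only [hf t, one_mul] using norm_inner_le_norm (𝕜 := ℂ) ((g + h) t) (h t)
  have h3 := norm_add_le ⟪(g + h) t, g t⟫_ℂ ⟪(g + h) t, h t⟫_ℂ
  rw [h1, norm_one] at h3
  linarith [ht (g t) ⟨t, rfl⟩]

/-- The translation group on `L²(ℝ)`. -/
noncomputable def translationL2 (s : ℝ) : Lp ℂ 2 (volume : Measure ℝ) →ₗᵢ[ℂ]
    Lp ℂ 2 (volume : Measure ℝ) :=
  Lp.compMeasurePreservingₗᵢ ℂ (s + ·) (measurePreserving_add_left volume s)

theorem translationL2_add (s t : ℝ) (x : Lp ℂ 2 (volume : Measure ℝ)) :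
    translationL2 (s + t) x = translationL2 t (translationL2 s x) := by
  have h := Lp.compMeasurePreserving_comp_apply x (measurePreserving_add_left volume s)
    (measurePreserving_add_left volume t)
  refine Eq.trans ?_ h
  change Lp.compMeasurePreserving _ _ x = _
  congr 2
  ext u
  simp [add_assoc]

theorem continuous_translationL2 (x : Lp ℂ 2 (volume : Measure ℝ)) :
    Continuous fun s => translationL2 s x := by
  let g : C(ℝ, C(ℝ, ℝ)) := (ContinuousMap.mk (fun a : ℝ × ℝ => a.1 + a.2) (by fun_prop)).curry
  exact continuous_const.compMeasurePreservingLp (f := fun _ : ℝ => x) g.continuous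
    (measurePreserving_add_left volume) ENNReal.ofNat_ne_top

/-- The indicator function of `[0, 1]` in `L²(ℝ)`. -/
noncomputable def unitIndicatorL2 : Lp ℂ 2 (volume : Measure ℝ) :=
  indicatorConstLp 2 (measurableSet_Icc (a := (0 : ℝ)) (b := 1)) (by simp) 1

theorem norm_unitIndicatorL2 : ‖unitIndicatorL2‖ = 1 := by
  simp [unitIndicatorL2, norm_indicatorConstLp]

theorem inner_translationL2_unitIndicatorL2 (s : ℝ) (y : Lp ℂ 2 (volume : Measure ℝ)) :
    ⟪translationL2 s unitIndicatorL2, y⟫_ℂ = ∫ x in (s + ·) ⁻¹' Set.Icc (0 : ℝ) 1, y x := by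
  rw [← L2.inner_indicatorConstLp_one (𝕜 := ℂ)
    (measurableSet_Icc.preimage (measurable_const_add s))
    ((measurePreserving_add_left volume s).measure_preimage
      measurableSet_Icc.nullMeasurableSet ▸ by simp) y]
  rfl

theorem tendsto_inner_translationL2 (y : Lp ℂ 2 (volume : Measure ℝ)) :
    Tendsto (fun s => ⟪translationL2 s unitIndicatorL2, y⟫_ℂ) atTop (𝓝 0) := by
  rw [Metric.tendsto_nhds]
  intro ε hε
  obtain ⟨g, hg, hgy, -, hgm⟩ := (Lp.memLp y).exists_hasCompactSupport_eLpNorm_sub_le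
    ENNReal.ofNat_ne_top (ε := ENNReal.ofReal (ε / 2)) (by simpa using hε)
  have hz : ‖y - hgm.toLp g‖ ≤ ε / 2 := by
    rw [← Lp.toLp_coeFn y (Lp.memLp y), ← MemLp.toLp_sub, Lp.norm_toLp]
    exact ENNReal.toReal_le_of_le_ofReal (by positivity) hgy
  obtain ⟨R, hR⟩ := hg.isCompact.isBounded.subset_closedBall 0
  filter_upwards [eventually_gt_atTop (R + 1)] with s hs
  have h0 : ⟪translationL2 s unitIndicatorL2, hgm.toLp g⟫_ℂ = 0 := by
    rw [inner_translationL2_unitIndicatorL2,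
      integral_congr_ae (ae_restrict_of_ae hgm.coeFn_toLp)]
    refine setIntegral_eq_zero_of_forall_eq_zero fun x hx => ?_
    by_contra hne
    have hxR := hR (subset_tsupport _ hne)
    rw [Metric.mem_closedBall, dist_zero_right, Real.norm_eq_abs] at hxR
    linarith [hx.2, neg_abs_le x]
  have h1 : ⟪translationL2 s unitIndicatorL2, y⟫_ℂ =
      ⟪translationL2 s unitIndicatorL2, y - hgm.toLp g⟫_ℂ := by
    rw [inner_sub_right, h0, sub_zero]
  have h2 := norm_inner_le_norm (𝕜 := ℂ) (translationL2 s unitIndicatorL2) (y - hgm.toLp g)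
  rw [LinearIsometry.norm_map, norm_unitIndicatorL2, one_mul] at h2
  rw [dist_zero_right, h1]
  linarith

/-- The operator sending `x ∈ L²(ℝ)` to the translation orbit of `x`, embedded in `H`. -/
noncomputable def orbitOperator {H : Type*} [NormedAddCommGroup H] [InnerProductSpace ℂ H]
    (J : Lp ℂ 2 (volume : Measure ℝ) →ₗᵢ[ℂ] H) : Lp ℂ 2 (volume : Measure ℝ) →L[ℂ] (ℝ →ᵇ H) :=
  LinearMap.mkContinuous
    { toFun := fun x => BoundedContinuousFunction.ofNormedAddCommGroup
        (fun t => J (translationL2 t x)) (J.continuous.comp (continuous_translationL2 x)) ‖x‖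
        (fun t => by simp)
      map_add' := fun x y => by ext t; simp
      map_smul' := fun c x => by ext t; simp }
    1 fun x => by
      rw [one_mul]
      exact BoundedContinuousFunction.norm_ofNormedAddCommGroup_le _ (norm_nonneg x)
        fun t => by simp

section OrbitOperator

variable {H : Type*} [NormedAddCommGroup H] [InnerProductSpace ℂ H]
  (J : Lp ℂ 2 (volume : Measure ℝ) →ₗᵢ[ℂ] H)

theorem orbitOperator_apply (x : Lp ℂ 2 (volume : Measure ℝ)) (t : ℝ) :
    orbitOperator J x t = J (translationL2 t x) := rfl

theorem translateBCF_orbitOperator (x : Lp ℂ 2 (volume : Measure ℝ)) (s : ℝ) :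
    translateBCF (orbitOperator J x) s = orbitOperator J (translationL2 s x) := by
  ext t
  simp [translateBCF, orbitOperator_apply, translationL2_add]

end OrbitOperator

/-- For every separable infinite-dimensional complex Hilbert space `H` there is
`f ∈ EAP₀(ℝ,H)` such that `t ↦ ‖f t‖` is continuous and `1`-periodic, the Bohr mean of
`‖f(·)‖` exists and is strictly positive, yet `f` is not pseudo almost periodic. -/
theorem exists_EAP0_norm_periodic_not_PAP
    (H : Type*) [NormedAddCommGroup H] [InnerProductSpace ℂ H] [CompleteSpace H]
    [TopologicalSpace.SeparableSpace H] (hH : ¬ FiniteDimensional ℂ H) :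
    ∃ f : ℝ →ᵇ H,
      IsCompact (closure ((toWeakSpace ℂ (ℝ →ᵇ H)) '' Set.range (translateBCF f))) ∧
      (0 : WeakSpace ℂ (ℝ →ᵇ H)) ∈
        closure ((toWeakSpace ℂ (ℝ →ᵇ H)) '' Set.range (translateBCF f)) ∧
      Continuous (fun t => ‖f t‖) ∧
      Function.Periodic (fun t => ‖f t‖) 1 ∧
      (∃ L : ℝ, 0 < L ∧
        Tendsto (fun T : ℝ => (1/(2*T)) * ∫ t in (-T)..T, ‖f t‖) atTop (𝓝 L)) ∧
      ¬ ∃ (g h : ℝ →ᵇ H), IsAP g ∧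
          Tendsto (fun T : ℝ => (1/(2*T)) * ∫ t in (-T)..T, ‖h t‖) atTop (𝓝 0) ∧
          f = g + h := by
  have : Fact ((2 : ℝ≥0∞) ≠ ∞) := ⟨ENNReal.ofNat_ne_top⟩
  obtain ⟨J⟩ := exists_linearIsometry_of_separable (K := Lp ℂ 2 (volume : Measure ℝ)) hH
  set f := orbitOperator J unitIndicatorL2 with hf_def
  have hf : ∀ t, ‖f t‖ = 1 := fun t => by
    simp [hf_def, orbitOperator_apply, norm_unitIndicatorL2]
  have hrange : Set.range (translateBCF f) =
      orbitOperator J '' Set.range fun s => translationL2 s unitIndicatorL2 := by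
    rw [← Set.range_comp]
    exact congrArg Set.range (funext fun s => translateBCF_orbitOperator J _ s)
  refine ⟨f, ?_, ?_, f.continuous.norm, fun t => by simp only [hf], ⟨1, one_pos, ?_⟩,
    not_PAP_of_weakly_null hf fun y => ?_⟩
  · rw [hrange]
    refine isCompact_closure_toWeakSpace_image _ (r := 1) ?_
    rintro _ ⟨s, rfl⟩
    simp [norm_unitIndicatorL2]
  · refine mem_closure_of_tendsto (b := atTop)
      (f := fun s : ℝ => toWeakSpace ℂ (ℝ →ᵇ H) (translateBCF f s)) ?_
      (Eventually.of_forall fun s => ⟨_, ⟨s, rfl⟩, rfl⟩)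
    refine (WeakBilin.tendsto_iff_forall_eval_tendsto _
      fun x y hxy => (SeparatingDual.eq_iff_forall_dual_eq (R := ℂ) (V := ℝ →ᵇ H)).2
        (LinearMap.congr_fun hxy)).2 fun l => ?_
    have hl : ∀ s, (topDualPairing ℂ (ℝ →ᵇ H)).flip
        (toWeakSpace ℂ (ℝ →ᵇ H) (translateBCF f s)) l = starRingEnd ℂ
          ⟪translationL2 s unitIndicatorL2,
            (InnerProductSpace.toDual ℂ _).symm (l.comp (orbitOperator J))⟫_ℂ := fun s => by
      rw [inner_conj_symm, InnerProductSpace.toDual_symm_apply, translateBCF_orbitOperator]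
      rfl
    refine Tendsto.congr (fun s => (hl s).symm) ?_
    exact (Complex.continuous_conj.tendsto' 0 (l 0) (by simp)).comp
      (tendsto_inner_translationL2 _)
  · refine tendsto_const_nhds.congr' ?_
    filter_upwards [eventually_gt_atTop 0] with T hT
    simp only [hf, intervalIntegral.integral_const, smul_eq_mul]
    field_simp
    ring
  · have hJ : ∀ t, ⟪f t, y⟫_ℂ =
        ⟪translationL2 t unitIndicatorL2, J.toContinuousLinearMap.adjoint y⟫_ℂ := fun t => by
      rw [ContinuousLinearMap.adjoint_inner_right]
      rfl
    simp_rw [hJ]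
    exact tendsto_inner_translationL2 _
end
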